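/- arXiv:1607.01986 — 2 statements merged into one kernel-verified Lean document; each statement's English description precedes it below -/
import Mathlib

section
/- Let k ≥ 1, D ≥ 2 be integers, delta, k1, tau0, beta > 0, q > 1, alpha ∈ ℝ, and nonnegative integers d_l (1 ≤ l ≤ D) with k·d_D − 1 ≥ k1·delta + k·d_l for 1 ≤ l ≤ D−1. Let Q, R_l ∈ ℂ[X] (1 ≤ l ≤ D) with deg(Q) ≥ deg(R_D) ≥ deg(R_l), Q(im) ≠ 0 and R_D(im) ≠ 0 for all m ∈ ℝ, and mu > deg(R_D)+1. Let P_m(tau) = Q(im) − R_D(im)(k·tau^k)^{d_D} and let Θ ⊆ ℂ be a closed set of the form Θ = cl(U) ∪ cl(U') ∪ {tau : |tau| ≥ R0} (the union of two closed unbounded sectors with vertex 0 and a closed annulus complement), so that q^delta·Θ ⊆ Θ, and assume the lower bound |P_m(tau)| ≥ C_P · r^{1/(k·d_D)} |R_D(im)| (1+|tau|)^{k·d_D−1} holds for all tau ∈ Θ and m ∈ ℝ, for some constants C_P, r > 0. Then there exists C3 > 0 (depending on q, alpha, delta, R_l, mu, R0, tau0, k1, k, d_l but not on r) such that for every 1 ≤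 l ≤ D−1, every C_l ∈ E_{(beta,mu)} and every f ∈ Exp^q_{(k1,beta,mu,alpha);Θ}: || (tau^{k·d_l}/P_m(tau)) ∫_ℝ C_l(m−m1) R_l(i·m1) f(q^delta·tau, m1) dm1 ||_{(k1,beta,mu,alpha);Θ} ≤ (C3/(C_P r^{1/(k·d_D)})) · ||f||_{(k1,beta,mu,alpha);Θ} · ||C_l||_{(beta,mu)}. -/
/- Statement 2: norm estimate for the q-difference/convolution operator on a
sectorial triangle frame Θ. -/

open MeasureTheory Set

noncomputable def eW (beta mu m : ℝ) : ℝ := (1 + |m|) ^ mu * Real.exp (beta * |m|)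

/-- Weight defining the norm of the space `Exp^q_{(k1,beta,mu,alpha);Θ}`. -/
noncomputable def qW (k1 tau0 q alpha beta mu : ℝ) (tau : ℂ) (m : ℝ) : ℝ :=
  eW beta mu m * (1 / ‖tau‖) *
    Real.exp (-(k1 / 2) * (Real.log (‖tau‖ + tau0)) ^ 2 / Real.log q
      - alpha * Real.log (‖tau‖ + tau0))

/-- A closed unbounded sector with vertex at the origin. -/
def closedSector (dir ap : ℝ) : Set ℂ :=
  {tau : ℂ | tau = 0 ∨ |Complex.arg tau - dir| ≤ ap}

lemma aux_upper (p : Polynomial ℂ) : ∃ c : ℝ, 0 < c ∧ ∀ m : ℝ,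
    ‖p.eval (Complex.I * m)‖ ≤ c * (1 + |m|) ^ p.natDegree := by
  refine ⟨(∑ i ∈ Finset.range (p.natDegree + 1), ‖p.coeff i‖) + 1, by positivity, fun m => ?_⟩
  rw [Polynomial.eval_eq_sum_range]
  refine (norm_sum_le _ _).trans ?_
  have h1 : ∑ i ∈ Finset.range (p.natDegree + 1), ‖p.coeff i * (Complex.I * m) ^ i‖
      ≤ ∑ i ∈ Finset.range (p.natDegree + 1), ‖p.coeff i‖ * (1 + |m|) ^ p.natDegree := by
    refine Finset.sum_le_sum fun i hi => ?_
    have hi' : i ≤ p.natDegree := by simpa [Nat.lt_succ_iff] using hi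
    rw [norm_mul, norm_pow, norm_mul, Complex.norm_I, one_mul, Complex.norm_real, Real.norm_eq_abs]
    refine mul_le_mul_of_nonneg_left ?_ (norm_nonneg _)
    calc |m| ^ i ≤ (1 + |m|) ^ i := by gcongr; linarith
      _ ≤ (1 + |m|) ^ p.natDegree := pow_le_pow_right₀ (by linarith [abs_nonneg m]) hi'
  refine h1.trans ?_
  rw [← Finset.sum_mul, add_mul]
  have : 0 ≤ 1 * (1 + |m|) ^ p.natDegree := by positivity
  linarith

lemma aux_lower (n : ℕ) : ∀ p : Polynomial ℂ, p.natDegree = n →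
    (∀ m : ℝ, p.eval (Complex.I * m) ≠ 0) → ∃ c : ℝ, 0 < c ∧ ∀ m : ℝ,
    (1 + |m|) ^ n ≤ c * ‖p.eval (Complex.I * m)‖ := by
  induction n with
  | zero =>
    intro p hp h0
    obtain ⟨a, rfl⟩ := Polynomial.natDegree_eq_zero.mp hp
    have ha : a ≠ 0 := by simpa using h0 0
    refine ⟨‖a‖⁻¹, by positivity, fun m => ?_⟩
    have : ‖a‖ ≠ 0 := by simpa using ha
    simp [this]
  | succ n ih =>
    intro p hp h0
    obtain ⟨a, ha⟩ := Complex.exists_root (f := p)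
      (Polynomial.natDegree_pos_iff_degree_pos.mp (by omega))
    obtain ⟨g, rfl⟩ := Polynomial.dvd_iff_isRoot.mpr ha
    have hg : g ≠ 0 := by
      rintro rfl
      exact h0 0 (by simp)
    have hgd : g.natDegree = n := by
      rw [Polynomial.natDegree_mul (Polynomial.X_sub_C_ne_zero a) hg,
        Polynomial.natDegree_X_sub_C] at hp
      omega
    obtain ⟨c, hc, hb⟩ := ih g hgd (fun m hm => h0 m (by simp [hm]))
    have hre : a.re ≠ 0 := by
      intro hre
      refine h0 a.im ?_
      have : Complex.I * (a.im : ℂ) = a := by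
        apply Complex.ext <;> simp [hre]
      rw [this]
      exact ha
    have hre' : 0 < |a.re| := abs_pos.mpr hre
    refine ⟨((1 + ‖a‖) / |a.re| + 1) * c, by positivity, fun m => ?_⟩
    have h1 : |a.re| ≤ ‖Complex.I * m - a‖ := by
      have := Complex.abs_re_le_norm (Complex.I * m - a)
      simpa using this
    have h2 : |m| ≤ ‖Complex.I * m - a‖ + ‖a‖ := by
      have := norm_add_le (Complex.I * m - a) a
      simpa using this
    have h3 : 1 + |m| ≤ ((1 + ‖a‖) / |a.re| + 1) * ‖Complex.I * m - a‖ := by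
      have : (1 + ‖a‖) ≤ (1 + ‖a‖) / |a.re| * ‖Complex.I * m - a‖ := by
        rw [div_mul_eq_mul_div, le_div_iff₀ hre']
        gcongr
      linarith
    rw [Polynomial.eval_mul, norm_mul, pow_succ]
    have he : ‖(Polynomial.X - Polynomial.C a).eval (Complex.I * (m : ℂ))‖
      = ‖Complex.I * m - a‖ := by simp
    rw [he]
    calc (1 + |m|) ^ n * (1 + |m|) ≤ (c * ‖g.eval (Complex.I * (m : ℂ))‖) *
          (((1 + ‖a‖) / |a.re| + 1) * ‖Complex.I * m - a‖) :=
          mul_le_mul (hb m) h3 (by positivity) (by positivity)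
      _ = _ := by ring

lemma aux_conv {a A B M : ℝ} (ha : 0 < a) (hA : 0 < A) (hB : 0 < B) (hM : 0 < M)
    (h : M ≤ A + B) :
    A ^ (-a) * B ^ (-a) ≤ 2 ^ a * M ^ (-a) * (A ^ (-a) + B ^ (-a)) := by
  have key : ∀ X : ℝ, 0 < X → M ≤ 2 * X → X ^ (-a) ≤ 2 ^ a * M ^ (-a) := by
    intro X hX hMX
    have h1 := Real.rpow_le_rpow_of_nonpos hM hMX (by linarith : -a ≤ 0)
    rw [Real.mul_rpow (by norm_num) hX.le] at h1
    have h2 : (2 : ℝ) ^ a * 2 ^ (-a) = 1 := by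
      rw [← Real.rpow_add (by norm_num)]; simp
    calc X ^ (-a) = 2 ^ a * (2 ^ (-a) * X ^ (-a)) := by rw [← mul_assoc, h2, one_mul]
      _ ≤ _ := by gcongr
  have pA : 0 < A ^ (-a) := Real.rpow_pos_of_pos hA _
  have pB : 0 < B ^ (-a) := Real.rpow_pos_of_pos hB _
  have pM : 0 < 2 ^ a * M ^ (-a) := by positivity
  rcases le_total A B with hAB | hAB
  · have := key B hB (by linarith)
    nlinarith
  · have := key A hA (by linarith)
    nlinarith

/-- the radial weight -/
noncomputable def auxE (k1 tau0 q alpha x : ℝ) : ℝ :=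
  (k1 / 2) * (Real.log (x + tau0)) ^ 2 / Real.log q + alpha * Real.log (x + tau0)

lemma aux_tau {k1 tau0 q alpha delta x : ℝ} (hdelta : 0 < delta) (hk1 : 0 < k1)
    (htau0 : 0 < tau0) (hq : 1 < q) (hx : 0 ≤ x) :
    Real.exp (auxE k1 tau0 q alpha (q ^ delta * x)) ≤
      Real.exp (|alpha| * (delta * Real.log q) + k1 * delta ^ 2 * Real.log q / 2) *
      (1 + tau0) ^ (k1 * delta) * (1 + x) ^ (k1 * delta) *
      Real.exp (auxE k1 tau0 q alpha x) := by
  have hlq : 0 < Real.log q := Real.log_pos hq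
  have hqd : 1 ≤ q ^ delta := Real.one_le_rpow hq.le hdelta.le
  have hL1 : Real.log (x + tau0) ≤ Real.log (q ^ delta * x + tau0) := by
    apply Real.log_le_log (by positivity)
    nlinarith
  have hL2 : Real.log (q ^ delta * x + tau0) ≤ Real.log (x + tau0) + delta * Real.log q := by
    rw [← Real.log_rpow (by linarith), ← Real.log_mul (by positivity) (by positivity)]
    apply Real.log_le_log (by positivity)
    nlinarith
  have hL3 : Real.log (x + tau0) ≤ Real.log (1 + tau0) + Real.log (1 + x) := by
    rw [← Real.log_mul (by positivity) (by positivity)]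
    apply Real.log_le_log (by positivity)
    nlinarith
  have hL4 : 0 ≤ Real.log (1 + tau0) + Real.log (1 + x) :=
    add_nonneg (Real.log_nonneg (by linarith)) (Real.log_nonneg (by linarith))
  rw [Real.rpow_def_of_pos (by positivity : 0 < 1 + tau0),
    Real.rpow_def_of_pos (by positivity : 0 < 1 + x), ← Real.exp_add, ← Real.exp_add,
    ← Real.exp_add, Real.exp_le_exp]
  unfold auxE
  generalize Real.log (x + tau0) = L at *
  generalize Real.log (q ^ delta * x + tau0) = L' at *
  obtain ⟨W, hW⟩ : ∃ W, W = Real.log (1 + tau0) + Real.log (1 + x) := ⟨_, rfl⟩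
  rw [← hW] at hL3 hL4
  generalize hlam : Real.log q = lam at *
  obtain ⟨s, rfl⟩ : ∃ s, L' = L + s := ⟨L' - L, by ring⟩
  have hs0 : 0 ≤ s := by linarith
  have hs1 : s ≤ delta * lam := by linarith
  have h1 : alpha * s ≤ |alpha| * (delta * lam) :=
    (mul_le_mul_of_nonneg_right (le_abs_self alpha) hs0).trans
      (mul_le_mul_of_nonneg_left hs1 (abs_nonneg _))
  have h2 : s * L ≤ (delta * lam) * W :=
    (mul_le_mul_of_nonneg_left hL3 hs0).trans (mul_le_mul_of_nonneg_right hs1 hL4)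
  have h3 : s ^ 2 ≤ (delta * lam) ^ 2 := by gcongr
  have h4 : (k1 / 2) * (L + s) ^ 2 / lam ≤
      (k1 / 2) * L ^ 2 / lam + k1 * delta * W + k1 * delta ^ 2 * lam / 2 := by
    rw [div_add' _ _ _ hlq.ne', div_add' _ _ _ hlq.ne', div_le_div_iff_of_pos_right hlq]
    nlinarith
  have h5 : k1 * delta * W = Real.log (1 + tau0) * (k1 * delta) +
      Real.log (1 + x) * (k1 * delta) := by rw [hW]; ring
  linarith

lemma qW_eq (k1 tau0 q alpha beta mu : ℝ) (tau : ℂ) (m : ℝ) :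
    qW k1 tau0 q alpha beta mu tau m = eW beta mu m * (1 / ‖tau‖) *
      Real.exp (-auxE k1 tau0 q alpha ‖tau‖) := by
  unfold qW auxE
  congr 2
  ring

lemma eW_pos (beta mu m : ℝ) : 0 < eW beta mu m := by
  unfold eW
  positivity

lemma aux_kernel {beta mu : ℝ} {N : ℕ} (hb : 0 < beta) (hmu : (N : ℝ) + 1 < mu) (m y : ℝ) :
    (eW beta mu (m - y))⁻¹ * (1 + |y|) ^ N * (eW beta mu y)⁻¹ ≤
      Real.exp (-(beta * |m|)) * (2 ^ (mu - N) * (1 + |m|) ^ (-(mu - N)) *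
        ((1 + |m - y|) ^ (-(mu - N)) + (1 + |y|) ^ (-(mu - N)))) := by
  have hA : 0 < 1 + |m - y| := by positivity
  have hB : 0 < 1 + |y| := by positivity
  have htri : |m| ≤ |m - y| + |y| := by
    have := abs_add_le (m - y) y
    simpa using this
  have hN : (0 : ℝ) ≤ N := Nat.cast_nonneg N
  refine le_trans ?_ (mul_le_mul_of_nonneg_left
    (aux_conv (by linarith : 0 < mu - N) hA hB (by positivity : 0 < 1 + |m|) (by linarith))
    (Real.exp_pos _).le)
  unfold eW
  rw [mul_inv, mul_inv, ← Real.exp_neg, ← Real.exp_neg, ← Real.rpow_neg hA.le,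
    ← Real.rpow_neg hB.le]
  have e1 : (1 + |y|) ^ N * (1 + |y|) ^ (-mu) = (1 + |y|) ^ (-(mu - N)) := by
    rw [← Real.rpow_natCast, ← Real.rpow_add hB]; congr 1; ring
  have e2 : (1 + |m - y|) ^ (-mu) ≤ (1 + |m - y|) ^ (-(mu - N)) :=
    Real.rpow_le_rpow_of_exponent_le (by linarith [abs_nonneg (m - y)]) (by linarith)
  have e3 : Real.exp (-(beta * |m - y|)) * Real.exp (-(beta * |y|)) ≤
      Real.exp (-(beta * |m|)) := by
    rw [← Real.exp_add, Real.exp_le_exp]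
    nlinarith
  calc _ = (Real.exp (-(beta * |m - y|)) * Real.exp (-(beta * |y|))) *
        ((1 + |m - y|) ^ (-mu) * ((1 + |y|) ^ N * (1 + |y|) ^ (-mu))) := by ring
    _ ≤ _ := by
      rw [e1]
      gcongr

theorem stmt_2 (k D : ℕ) (hk : 1 ≤ k) (hD : 2 ≤ D)
    (delta k1 tau0 q alpha mu R0 : ℝ)
    (hdelta : 0 < delta) (hk1 : 0 < k1) (htau0 : 0 < tau0) (hq : 1 < q) (hR0 : 0 < R0)
    (d : ℕ → ℕ)
    (Q : Polynomial ℂ) (R : ℕ → Polynomial ℂ)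
    (hcoef : ∀ l, 1 ≤ l → l ≤ D - 1 →
      k1 * delta + (k * d l : ℕ) ≤ ((k * d D : ℕ) : ℝ) - 1)
    (hdeg : ∀ l, 1 ≤ l → l ≤ D - 1 → (R l).natDegree ≤ (R D).natDegree)
    (hdegQ : (R D).natDegree ≤ Q.natDegree)
    (hmu : ((R D).natDegree : ℝ) + 1 < mu)
    (hQ0 : ∀ m : ℝ, Q.eval (Complex.I * m) ≠ 0)
    (hRD0 : ∀ m : ℝ, (R D).eval (Complex.I * m) ≠ 0) :
    ∃ C3 : ℝ, 0 < C3 ∧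
    ∀ beta : ℝ, 0 < beta →
    ∀ Theta : Set ℂ, IsClosed Theta →
      (∃ d1 a1 d2 a2 : ℝ, 0 < a1 ∧ 0 < a2 ∧
        Theta = closedSector d1 a1 ∪ closedSector d2 a2 ∪ {tau : ℂ | R0 ≤ ‖tau‖}) →
      (∀ tau ∈ Theta, ((q ^ delta : ℝ) : ℂ) * tau ∈ Theta) →
    ∀ CP r : ℝ, 0 < CP → 0 < r →
      (∀ tau ∈ Theta, ∀ m : ℝ,
        CP * r ^ (1 / (k * d D : ℝ)) * ‖(R D).eval (Complex.I * m)‖ *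
            (1 + ‖tau‖) ^ (k * d D - 1)
          ≤ ‖Q.eval (Complex.I * m) - (R D).eval (Complex.I * m) * ((k : ℂ) * tau ^ k) ^ (d D)‖) →
    ∀ l, 1 ≤ l → l ≤ D - 1 →
    ∀ Cl : ℝ → ℂ, Continuous Cl →
    ∀ BC : ℝ, (∀ m : ℝ, eW beta mu m * ‖Cl m‖ ≤ BC) →
    ∀ f : ℂ → ℝ → ℂ,
      ContinuousOn (fun p : ℂ × ℝ => f p.1 p.2) (Theta ×ˢ univ) →
      (∀ m : ℝ, DifferentiableOn ℂ (fun tau => f tau m) (interior Theta)) →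
    ∀ Bf : ℝ,
      (∀ tau ∈ Theta, ∀ m : ℝ, qW k1 tau0 q alpha beta mu tau m * ‖f tau m‖ ≤ Bf) →
    ∀ tau ∈ Theta, ∀ m : ℝ,
      qW k1 tau0 q alpha beta mu tau m *
        ‖tau ^ (k * d l) /
            (Q.eval (Complex.I * m) - (R D).eval (Complex.I * m) * ((k : ℂ) * tau ^ k) ^ (d D)) *
          ∫ m1 : ℝ, Cl (m - m1) * (R l).eval (Complex.I * m1) *
            f (((q ^ delta : ℝ) : ℂ) * tau) m1‖
        ≤ C3 / (CP * r ^ (1 / (k * d D : ℝ))) * Bf * BC := by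
  obtain ⟨cD, hcD, hlow⟩ := aux_lower _ (R D) rfl hRD0
  choose cU hcU hup using fun l => aux_upper (R l)
  obtain ⟨cR, hcRdef⟩ : ∃ c, c = ∑ l ∈ Finset.range D, cU l := ⟨_, rfl⟩
  have hcRl : ∀ l, l ≤ D - 1 → cU l ≤ cR := by
    intro l hl
    rw [hcRdef]
    exact Finset.single_le_sum (f := cU) (fun i _ => (hcU i).le)
      (Finset.mem_range.mpr (by omega))
  have hcR : 0 < cR := lt_of_lt_of_le (hcU 0) (hcRl 0 (by omega))
  obtain ⟨N, hN⟩ : ∃ N, N = (R D).natDegree := ⟨_, rfl⟩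
  rw [← hN] at hmu hlow
  obtain ⟨a, ha⟩ : ∃ a, a = mu - N := ⟨_, rfl⟩
  have hN0 : (0 : ℝ) ≤ N := Nat.cast_nonneg N
  have ha1 : 1 < a := by linarith
  have hint : Integrable (fun x : ℝ => (1 + |x|) ^ (-a)) := by
    have := integrable_one_add_norm (E := ℝ) (μ := volume) (r := a) (by simpa using ha1)
    simpa using this
  obtain ⟨J, hJ⟩ : ∃ J, J = ∫ x : ℝ, (1 + |x|) ^ (-a) := ⟨_, rfl⟩
  have hJ0 : 0 ≤ J := by
    rw [hJ]
    exact integral_nonneg fun x => by positivity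
  have hq0 : 0 < q := by linarith
  have hqd : 0 < q ^ delta := Real.rpow_pos_of_pos hq0 _
  obtain ⟨K, hK⟩ : ∃ K, K = Real.exp (|alpha| * (delta * Real.log q) +
      k1 * delta ^ 2 * Real.log q / 2) * (1 + tau0) ^ (k1 * delta) := ⟨_, rfl⟩
  have hK0 : 0 < K := by rw [hK]; positivity
  refine ⟨cD * cR * 2 ^ a * (2 * (J + 1)) * (K * q ^ delta), by positivity, ?_⟩
  intro beta hbeta Theta _ _ hTq CP r hCP hr hP l hl1 hl2 Cl _ BC hBC f _ _ Bf hBf tau htau m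
  have hBC0 : 0 ≤ BC := (mul_nonneg (eW_pos beta mu 0).le (norm_nonneg _)).trans (hBC 0)
  have hqWnn : ∀ t y, 0 ≤ qW k1 tau0 q alpha beta mu t y := by
    intro t y
    rw [qW_eq]
    have := eW_pos beta mu y
    positivity
  have hBf0 : 0 ≤ Bf := (mul_nonneg (hqWnn tau 0) (norm_nonneg _)).trans (hBf tau htau 0)
  obtain ⟨S, hS⟩ : ∃ S, S = CP * r ^ (1 / (k * d D : ℝ)) := ⟨_, rfl⟩
  have hS0 : 0 < S := by rw [hS]; positivity
  have hPm := hP tau htau m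
  rw [← hS] at hPm ⊢
  by_cases ht0 : tau = 0
  · have : qW k1 tau0 q alpha beta mu tau m = 0 := by simp [qW, ht0]
    rw [this, zero_mul]
    positivity
  have hx : 0 < ‖tau‖ := norm_pos_iff.mpr ht0
  have hTn : ‖((q ^ delta : ℝ) : ℂ) * tau‖ = q ^ delta * ‖tau‖ := by
    rw [norm_mul, Complex.norm_real, Real.norm_of_nonneg hqd.le]
  have hfT : ∀ y, ‖f (((q ^ delta : ℝ) : ℂ) * tau) y‖ ≤ Bf * (q ^ delta * ‖tau‖) *
      Real.exp (auxE k1 tau0 q alpha (q ^ delta * ‖tau‖)) * (eW beta mu y)⁻¹ := by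
    intro y
    have h := hBf _ (hTq tau htau) y
    rw [qW_eq, hTn, Real.exp_neg] at h
    have h1 := eW_pos beta mu y
    have h2 := Real.exp_pos (auxE k1 tau0 q alpha (q ^ delta * ‖tau‖))
    have h3 : 0 < q ^ delta * ‖tau‖ := by positivity
    generalize Real.exp (auxE k1 tau0 q alpha (q ^ delta * ‖tau‖)) = e at *
    generalize eW beta mu y = w at *
    generalize q ^ delta * ‖tau‖ = t at *
    generalize ‖f (((q ^ delta : ℝ) : ℂ) * tau) y‖ = g at *
    calc g = (w * (1 / t) * e⁻¹ * g) * (t * e * w⁻¹) := by field_simp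
      _ ≤ Bf * (t * e * w⁻¹) := by gcongr
      _ = _ := by ring
  have hCl : ∀ y, ‖Cl y‖ ≤ BC * (eW beta mu y)⁻¹ := by
    intro y
    rw [← div_eq_mul_inv, le_div_iff₀ (eW_pos beta mu y), mul_comm]
    exact hBC y
  have hRl : ∀ y : ℝ, ‖(R l).eval (Complex.I * y)‖ ≤ cR * (1 + |y|) ^ N := by
    intro y
    refine (hup l y).trans ?_
    have := hcRl l hl2
    have h2 : (1 + |y|) ^ (R l).natDegree ≤ (1 + |y|) ^ N :=
      pow_le_pow_right₀ (by linarith [abs_nonneg y]) (hN ▸ hdeg l hl1 hl2)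
    gcongr
  obtain ⟨F, hF⟩ : ∃ F, F = (q ^ delta * ‖tau‖) *
      Real.exp (auxE k1 tau0 q alpha (q ^ delta * ‖tau‖)) := ⟨_, rfl⟩
  have hF0 : 0 < F := by rw [hF]; positivity
  obtain ⟨G, hG⟩ : ∃ G, G = BC * cR * (Bf * F) * (Real.exp (-(beta * |m|)) *
      (2 ^ a * (1 + |m|) ^ (-a))) := ⟨_, rfl⟩
  have hG0 : 0 ≤ G := by rw [hG]; positivity
  have hintbd : ‖∫ m1 : ℝ, Cl (m - m1) * (R l).eval (Complex.I * m1) *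
      f (((q ^ delta : ℝ) : ℂ) * tau) m1‖ ≤ G * (2 * (J + 1)) := by
    have hint2 : Integrable (fun y : ℝ => (1 + |m - y|) ^ (-a)) := hint.comp_sub_left m
    have h1 := norm_integral_le_of_norm_le (μ := volume) (f := fun m1 : ℝ =>
      Cl (m - m1) * (R l).eval (Complex.I * m1) * f (((q ^ delta : ℝ) : ℂ) * tau) m1)
      (g := fun y => G * ((1 + |m - y|) ^ (-a) + (1 + |y|) ^ (-a)))
      ((hint2.add hint).const_mul G) (Filter.Eventually.of_forall fun y => by
        rw [norm_mul, norm_mul]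
        have w1 := eW_pos beta mu (m - y)
        have w2 := eW_pos beta mu y
        calc ‖Cl (m - y)‖ * ‖(R l).eval (Complex.I * (y : ℂ))‖ *
              ‖f (((q ^ delta : ℝ) : ℂ) * tau) y‖
            ≤ (BC * (eW beta mu (m - y))⁻¹) * (cR * (1 + |y|) ^ N) *
              (Bf * (q ^ delta * ‖tau‖) *
      Real.exp (auxE k1 tau0 q alpha (q ^ delta * ‖tau‖)) * (eW beta mu y)⁻¹) := by
              gcongr
              · exact hCl _
              · exact hRl _
              · exact hfT _
          _ = (BC * cR * (Bf * F)) *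
              ((eW beta mu (m - y))⁻¹ * (1 + |y|) ^ N * (eW beta mu y)⁻¹) := by
              rw [hF]; ring
          _ ≤ (BC * cR * (Bf * F)) * (Real.exp (-(beta * |m|)) * (2 ^ (mu - N) *
              (1 + |m|) ^ (-(mu - N)) *
              ((1 + |m - y|) ^ (-(mu - N)) + (1 + |y|) ^ (-(mu - N))))) :=
              mul_le_mul_of_nonneg_left (aux_kernel hbeta hmu m y) (by positivity)
          _ = _ := by rw [← ha, hG]; ring)
    refine h1.trans ?_
    rw [integral_const_mul, integral_add hint2 hint,
      integral_sub_left_eq_self (fun x : ℝ => (1 + |x|) ^ (-a)) volume m, ← hJ]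
    gcongr
    linarith
  -- lower bound for the denominator
  obtain ⟨P, hPdef⟩ : ∃ P, P = Q.eval (Complex.I * m) -
      (R D).eval (Complex.I * m) * ((k : ℂ) * tau ^ k) ^ (d D) := ⟨_, rfl⟩
  rw [← hPdef] at hPm ⊢
  obtain ⟨n', hn'⟩ : ∃ n', n' = k * d D - 1 := ⟨_, rfl⟩
  rw [← hn'] at hPm
  have hPm' : S * (1 + |m|) ^ N * (1 + ‖tau‖) ^ n' ≤ cD * ‖P‖ := by
    calc S * (1 + |m|) ^ N * (1 + ‖tau‖) ^ n'
        ≤ S * (cD * ‖(R D).eval (Complex.I * m)‖) * (1 + ‖tau‖) ^ n' := by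
          gcongr
          exact hlow m
      _ = cD * (S * ‖(R D).eval (Complex.I * m)‖ * (1 + ‖tau‖) ^ n') := by ring
      _ ≤ _ := by gcongr
  have hP0 : 0 < ‖P‖ := by
    have : 0 < cD * ‖P‖ := lt_of_lt_of_le (by positivity) hPm'
    exact pos_of_mul_pos_right this hcD.le
  have hexp : (1 + ‖tau‖) ^ (k1 * delta) * ‖tau‖ ^ (k * d l) ≤ (1 + ‖tau‖) ^ n' := by
    have h := hcoef l hl1 hl2
    have hcast : ((k * d D : ℕ) : ℝ) - 1 = (n' : ℝ) := by
      have h1 : 1 ≤ k * d D := by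
        have : (1 : ℝ) ≤ ((k * d D : ℕ) : ℝ) := by
          have h3 : (0 : ℝ) ≤ (k * d l : ℕ) := Nat.cast_nonneg _
          have h4 : 0 < k1 * delta := by positivity
          linarith
        exact_mod_cast this
      rw [hn', Nat.cast_sub h1]
      simp
    rw [hcast] at h
    calc (1 + ‖tau‖) ^ (k1 * delta) * ‖tau‖ ^ (k * d l)
        ≤ (1 + ‖tau‖) ^ (k1 * delta) * (1 + ‖tau‖) ^ (k * d l) := by
          gcongr
          linarith
      _ = (1 + ‖tau‖) ^ (k1 * delta + (k * d l : ℕ)) := by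
          rw [Real.rpow_add (by positivity), Real.rpow_natCast]
      _ ≤ (1 + ‖tau‖) ^ (n' : ℝ) :=
          Real.rpow_le_rpow_of_exponent_le (by linarith) h
      _ = _ := Real.rpow_natCast _ _
  have htaub := aux_tau (alpha := alpha) hdelta hk1 htau0 hq hx.le
  rw [← hK] at htaub
  have heW : eW beta mu m * (Real.exp (-(beta * |m|)) * (1 + |m|) ^ (-a)) = (1 + |m|) ^ N := by
    unfold eW
    have hM : 0 < 1 + |m| := by positivity
    have e1 : Real.exp (beta * |m|) * Real.exp (-(beta * |m|)) = 1 := by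
      rw [← Real.exp_add]; simp
    have e2 : (1 + |m|) ^ mu * (1 + |m|) ^ (-a) = (1 + |m|) ^ N := by
      rw [← Real.rpow_add hM, ← Real.rpow_natCast]; congr 1; rw [ha]; ring
    calc _ = ((1 + |m|) ^ mu * (1 + |m|) ^ (-a)) *
          (Real.exp (beta * |m|) * Real.exp (-(beta * |m|))) := by ring
      _ = _ := by rw [e1, e2, mul_one]
  rw [norm_mul, norm_div, norm_pow, qW_eq, Real.exp_neg]
  have hE := Real.exp_pos (auxE k1 tau0 q alpha ‖tau‖)
  have hw := eW_pos beta mu m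
  generalize Real.exp (auxE k1 tau0 q alpha ‖tau‖) = E at *
  calc _ ≤ eW beta mu m * (1 / ‖tau‖) * E⁻¹ * (‖tau‖ ^ (k * d l) / ‖P‖ * (G * (2 * (J + 1)))) := by
        gcongr
    _ = (eW beta mu m * (Real.exp (-(beta * |m|)) * (1 + |m|) ^ (-a))) *
        (q ^ delta * E⁻¹ * ‖tau‖ ^ (k * d l)) *
        (BC * cR * Bf * 2 ^ a * (2 * (J + 1)) / ‖P‖) *
        Real.exp (auxE k1 tau0 q alpha (q ^ delta * ‖tau‖)) := by
        rw [hG, hF]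
        field_simp
    _ ≤ (1 + |m|) ^ N *
        (q ^ delta * E⁻¹ * ‖tau‖ ^ (k * d l)) *
        (BC * cR * Bf * 2 ^ a * (2 * (J + 1)) / ‖P‖) *
        (K * (1 + ‖tau‖) ^ (k1 * delta) * E) := by
        rw [heW]
        gcongr
    _ = ((1 + |m|) ^ N * ((1 + ‖tau‖) ^ (k1 * delta) * ‖tau‖ ^ (k * d l))) / ‖P‖ *
        (cR * 2 ^ a * (2 * (J + 1)) * (K * q ^ delta) * Bf * BC) := by
        field_simp
    _ ≤ (cD / S) * (cR * 2 ^ a * (2 * (J + 1)) * (K * q ^ delta) * Bf * BC) := by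
        refine mul_le_mul_of_nonneg_right ?_ (by positivity)
        rw [div_le_div_iff₀ hP0 hS0]
        refine le_trans ?_ hPm'
        calc _ ≤ (1 + |m|) ^ N * (1 + ‖tau‖) ^ n' * S := by gcongr
          _ = _ := by ring
    _ = _ := by ring
end

section
/- (q-Gevrey Ramis–Sibuya theorem.) Let (F, ||·||_F) be a complex Banach space, q > 1 a real number, k ≥ 1 an integer, and {E_p}_{0≤p≤ς−1} a good covering in ℂ*. For each 0 ≤ p ≤ ς−1 let G_p : E_p → F be holomorphic, and set Δ_p(eps) = G_{p+1}(eps) − G_p(eps) on Z_p = E_{p+1} ∩ E_p (with E_ς = E_0 and G_ς = G_0). Assume: (1) each G_p is bounded as eps → 0 on E_p; (2) each Δ_p is q-exponentially flat of order k on Z_p, i.e. there exist C_p^1 ∈ ℝ and C_p^2 > 0 with ||Δ_p(eps)||_F ≤ C_p^2 |eps|^{C_p^1} exp( −(k/(2 log q)) log^2 |eps| ) for all eps ∈ Z_p. Then there exists a formal power series Ĝ(eps) ∈ F[[eps]] which is the common q-Gevrey asymptotic expansion of order 1/k of G_p on E_p, for every 0 ≤ p ≤ ς−1. -/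
/- Statement 11: q-Gevrey version of the Ramis-Sibuya theorem. -/

/-- An open bounded sector centered at the origin, of radius `r`,
with arguments ranging in `(θ1, θ2)`. -/
def planarSector (θ1 θ2 r : ℝ) : Set ℂ :=
  {z : ℂ | ∃ ρ θ : ℝ, 0 < ρ ∧ ρ < r ∧ θ1 < θ ∧ θ < θ2 ∧
    z = (ρ : ℂ) * Complex.exp ((θ : ℂ) * Complex.I)}

/-- `f : V → F` admits `Σ fn n ε^n` as q-Gevrey asymptotic expansion of order `1/kk` on `V`. -/
def qAsymp {F : Type*} [NormedAddCommGroup F] [NormedSpace ℂ F]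
    (q kk : ℝ) (V : Set ℂ) (f : ℂ → F) (fn : ℕ → F) : Prop :=
  ∀ θ1 θ2 r : ℝ, planarSector θ1 θ2 r ⊆ V →
    closure (planarSector θ1 θ2 r) ⊆ V ∪ {0} →
    ∃ A C : ℝ, 0 < A ∧ 0 < C ∧
      ∀ N : ℕ, ∀ eps ∈ planarSector θ1 θ2 r,
        ‖f eps - ∑ n ∈ Finset.range (N + 1), eps ^ n • fn n‖
          ≤ C * A ^ (N + 1) * q ^ (((N : ℝ) + 1) * N / (2 * kk)) * ‖eps‖ ^ (N + 1)

/-- A good covering in `ℂ*` by `ς` open sectors of radius `eps0`. -/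
def IsGoodCovering (ς : ℕ) (eps0 : ℝ) (E : ℕ → Set ℂ) : Prop :=
  (∀ p < ς, ∃ θ1 θ2 : ℝ, θ1 < θ2 ∧ θ2 - θ1 ≤ 2 * Real.pi ∧
      E p = planarSector θ1 θ2 eps0) ∧
  (∀ p < ς, (E p ∩ E ((p + 1) % ς)).Nonempty) ∧
  (∀ p1 < ς, ∀ p2 < ς, ∀ p3 < ς, p1 ≠ p2 → p1 ≠ p3 → p2 ≠ p3 →
      E p1 ∩ E p2 ∩ E p3 = ∅) ∧
  (⋃ p ∈ Finset.range ς, E p) = Metric.ball (0 : ℂ) eps0 \ {0}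

open Complex in
lemma one_sub_exp_lower (u : ℂ) (c : ℝ) (hc : Real.cos u.im ≤ 1 - 2*c) (hc1 : 0 ≤ c) (hc2 : c ≤ 1):
    c ≤ ‖1 - exp u‖ := by
  have h1 : ‖1 - exp u‖ ^ 2 = 1 - 2 * Real.exp u.re * Real.cos u.im + Real.exp u.re ^ 2 := by
    rw [← Complex.normSq_eq_norm_sq, Complex.normSq_apply]
    simp [Complex.exp_re, Complex.exp_im]
    nlinarith [Real.sin_sq_add_cos_sq u.im]
  have h2 : c ≤ ‖1 - exp u‖ ^ 2 := by
    rw [h1]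
    have hs := Real.exp_pos u.re
    have := Real.neg_one_le_cos u.im
    generalize Real.cos u.im = C at *
    generalize Real.exp u.re = s at *
    rcases le_total 0 C with h | h
    · nlinarith [sq_nonneg (s - C)]
    · nlinarith [mul_nonneg hs.le (neg_nonneg.2 h), sq_nonneg s]
  nlinarith [norm_nonneg (1 - exp u)]

lemma cos_le_of_mem (δ φ : ℝ) (h0 : 0 ≤ δ) (hπ : δ ≤ Real.pi) (h1 : δ ≤ φ) (h2 : φ ≤ 2 * Real.pi - δ) :
    Real.cos φ ≤ Real.cos δ := by
  rcases le_total φ Real.pi with h | h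
  · exact Real.cos_le_cos_of_nonneg_of_le_pi h0 h h1
  · rw [← Real.cos_two_pi_sub φ]
    exact Real.cos_le_cos_of_nonneg_of_le_pi h0 (by linarith) (by linarith)

open Complex in
lemma rect_zero {F : Type*} [NormedAddCommGroup F] [NormedSpace ℂ F] [CompleteSpace F]
    (f : ℂ → F) (x1 x2 a b : ℝ) (hx : x1 ≤ x2) (hab : a ≤ b)
    (H : ∀ w : ℂ, x1 ≤ w.re → w.re ≤ x2 → a ≤ w.im → w.im ≤ b → DifferentiableAt ℂ f w) :
    (∫ x in x1..x2, f (x + a * I)) - (∫ x in x1..x2, f (x + b * I))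
      + I • (∫ y in a..b, f (x2 + y * I)) - I • (∫ y in a..b, f (x1 + y * I)) = 0 := by
  have := Complex.integral_boundary_rect_eq_zero_of_differentiableOn f (x1 + a * I) (x2 + b * I) ?_
  · simpa using this
  · intro w hw
    simp [mem_reProdIm, Set.uIcc_of_le hx, Set.uIcc_of_le hab] at hw
    exact (H w hw.1.1 hw.1.2 hw.2.1 hw.2.2).differentiableWithinAt

open Complex in
lemma cone_abs {F : Type*} [NormedAddCommGroup F] [NormedSpace ℂ F] [CompleteSpace F]
    (E : ℕ → Set ℂ) (R : ℕ → ℂ → F) (n : ℕ) (hn : 1 ≤ n) (α : ℕ → ℝ) (X x1 x2 M K c0 : ℝ)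
    (hα : ∀ j < n, α j ≤ α (j+1)) (hαn : α n = α 0 + 2 * Real.pi)
    (hE : ∀ j, IsOpen (E j)) (hd : ∀ j, DifferentiableOn ℂ (R j) (E j))
    (hmem : ∀ j < n, ∀ w : ℂ, w.re < X → α j ≤ w.im → w.im ≤ α (j+1) → exp w ∈ E j)
    (hRn : R n = R 0) (hEn : E n = E 0)
    (hM : ∀ j, ∀ z ∈ E j, ‖R j z‖ ≤ M)
    (hK0 : 0 ≤ K)
    (hK : ∀ j < n, ∀ z ∈ E j, z ∈ E (j+1) → ‖R (j+1) z - R j z‖ ≤ K * ‖z‖^2)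
    (hx2 : x2 < X) (hc0 : 0 < c0)
    (w0 : ℂ) (hw0 : α 0 ≤ w0.im) (hw0' : w0.im ≤ α 1) (hw0r : ‖exp w0‖ ≤ Real.exp x2 / 2) (hx1 : x1 < w0.re)
    (hsep : ∀ j ≤ n, ∀ x : ℝ, c0 * ‖exp (x + α j * I)‖ ≤ ‖exp (x + α j * I) - exp w0‖)
    (hne : ∀ j < n, 1 ≤ j → ∀ w : ℂ, α j ≤ w.im → w.im ≤ α (j+1) → exp w ≠ exp w0) :
    ‖(2 * Real.pi : ℂ) • R 0 (exp w0) - (∑ j ∈ Finset.range n, (∫ y in (α j)..(α (j+1)), R j (exp (x2 + y * I)))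
      - I • ∑ j ∈ Finset.range n, ∫ x in x1..x2, (R (j+1) (exp (x + α (j+1) * I)) - R j (exp (x + α (j+1) * I))))‖
      ≤ ‖exp w0‖ * (8 * Real.pi * M / Real.exp x2 + n * K * Real.exp x2 / c0)
        + 4 * Real.pi * M * (Real.exp x1 / (‖exp w0‖ - Real.exp x1)) := by
  set ε := exp w0 with hε
  have hεn : ‖ε‖ = Real.exp w0.re := by rw [hε, Complex.norm_exp]
  have hnorm : ∀ x y : ℝ, ‖exp (x + y * I)‖ = Real.exp x := by
    intro x y; rw [Complex.norm_exp]; simp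
  have hx0 : w0.re < x2 := by
    rw [hεn] at hw0r
    have := Real.exp_pos x2
    exact Real.exp_lt_exp.1 (by linarith)
  have hx12 : x1 ≤ x2 := by linarith
  have hεE : ε ∈ E 0 := hmem 0 (by omega) w0 (by linarith) hw0 (by simpa using hw0')
  set c := R 0 ε with hc
  have hcM : ‖c‖ ≤ M := hM 0 _ hεE
  have hM0 : 0 ≤ M := (norm_nonneg _).trans hcM
  -- right edges
  have hmemR : ∀ j < n, ∀ x : ℝ, x < X → exp (x + α (j+1) * I) ∈ E j := by
    intro j hj x hx
    exact hmem j hj _ (by simpa using hx) (by simpa using hα j hj) (by simp)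
  have hmemL : ∀ j ≤ n, ∀ x : ℝ, x < X → exp (x + α j * I) ∈ E j := by
    intro j hj x hx
    rcases hj.lt_or_eq with h | h
    · exact hmem j h _ (by simpa using hx) (by simp) (by simpa using hα j h)
    · rw [h, hEn, hαn]
      have : exp (x + ((α 0 + 2 * Real.pi : ℝ):ℂ) * I) = exp (x + α 0 * I) := by
        rw [← Complex.exp_periodic (x + α 0 * I)]
        congr 1; push_cast; ring
      rw [this]
      exact hmem 0 (by omega) _ (by simpa using hx) (by simp) (by simpa using hα 0 (by omega))
  have hneR : ∀ j ≤ n, ∀ x : ℝ, exp (x + α j * I) ≠ ε := by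
    intro j hj x h
    have := hsep j hj x
    rw [h, sub_self, norm_zero, hεn] at this
    have := Real.exp_pos w0.re
    nlinarith
  have hneV : ∀ x y : ℝ, x ≠ w0.re → exp (x + y * I) ≠ ε := by
    intro x y hx h
    have := congrArg norm h
    rw [hnorm, hεn] at this
    exact hx (Real.exp_injective this)
  set f : ℕ → ℂ → F := fun j w => (exp w / (exp w - ε)) • (R j (exp w) - c) with hf
  -- differentiability
  have hRd : ∀ j w, exp w ∈ E j → DifferentiableAt ℂ (fun w => R j (exp w)) w := by
    intro j w hw
    have h1 : DifferentiableAt ℂ (R j) (exp w) := (hd j).differentiableAt ((hE j).mem_nhds hw)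
    exact h1.comp w Complex.differentiable_exp.differentiableAt
  have hkd : ∀ w, exp w ≠ ε → DifferentiableAt ℂ (fun w => exp w / (exp w - ε)) w := by
    intro w hw
    exact Complex.differentiable_exp.differentiableAt.div
      (Complex.differentiable_exp.differentiableAt.sub_const _) (sub_ne_zero.2 hw)
  have hfd : ∀ j w, exp w ∈ E j → exp w ≠ ε → DifferentiableAt ℂ (f j) w := by
    intro j w hw hw'
    exact (hkd w hw').smul ((hRd j w hw).sub_const c)
  have hrect : ∀ j < n, (∫ x in x1..x2, f j (x + α j * I)) - (∫ x in x1..x2, f j (x + α (j+1) * I))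
      + I • (∫ y in (α j)..(α (j+1)), f j (x2 + y * I)) - I • (∫ y in (α j)..(α (j+1)), f j (x1 + y * I)) = 0 := by
    intro j hj
    rcases Nat.eq_zero_or_pos j with h0 | h0
    · subst h0
      have key := rect_zero (fun w => exp w • dslope (R 0) ε (exp w)) x1 x2 (α 0) (α (0+1)) hx12 (hα 0 hj) ?_
      · have e : ∀ w, exp w ≠ ε → exp w • dslope (R 0) ε (exp w) = f 0 w := by
          intro w hw
          rw [dslope_of_ne _ hw, slope_def_module, smul_smul]
          simp only [hf, div_eq_mul_inv]
          rfl
        simp only [e _ (hneR 0 (by omega) _), e _ (hneR (0+1) (by omega) _),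
          e _ (hneV x2 _ hx0.ne'), e _ (hneV x1 _ hx1.ne)] at key
        exact key
      · intro w h1 h2 h3 h4
        have hw : exp w ∈ E 0 := hmem 0 hj w (by linarith) h3 h4
        have h5 : DifferentiableAt ℂ (dslope (R 0) ε) (exp w) :=
          ((Complex.differentiableOn_dslope ((hE 0).mem_nhds hεE)).2 (hd 0)).differentiableAt ((hE 0).mem_nhds hw)
        exact Complex.differentiable_exp.differentiableAt.smul
          (h5.comp w Complex.differentiable_exp.differentiableAt)
    · apply rect_zero _ _ _ _ _ hx12 (hα j hj)
      intro w h1 h2 h3 h4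
      exact hfd j w (hmem j hj w (by linarith) h3 h4) (hne j hj h0 w h3 h4)
  -- continuity along segments
  have hlineH : ∀ a : ℝ, Continuous (fun x : ℝ => ((x:ℂ) + a * I)) := by intro a; fun_prop
  have hlineV : ∀ x : ℝ, Continuous (fun y : ℝ => ((x:ℂ) + y * I)) := by intro a; fun_prop
  have intH : ∀ (g : ℂ → F) (a : ℝ), (∀ x : ℝ, x1 ≤ x → x ≤ x2 → DifferentiableAt ℂ g (x + a * I)) →
      IntervalIntegrable (fun x : ℝ => g (x + a * I)) MeasureTheory.volume x1 x2 := by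
    intro g a hg
    apply ContinuousOn.intervalIntegrable
    rw [Set.uIcc_of_le hx12]
    intro x hx
    have := (hg x hx.1 hx.2).continuousAt
    exact (ContinuousAt.comp (f := fun x : ℝ => ((x:ℂ) + a * I)) this (hlineH a).continuousAt).continuousWithinAt
  have intV : ∀ (g : ℂ → F) (x : ℝ), ∀ j < n, (∀ y : ℝ, α j ≤ y → y ≤ α (j+1) → DifferentiableAt ℂ g (x + y * I)) →
      IntervalIntegrable (fun y : ℝ => g (x + y * I)) MeasureTheory.volume (α j) (α (j+1)) := by
    intro g x j hj hg
    apply ContinuousOn.intervalIntegrable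
    rw [Set.uIcc_of_le (hα j hj)]
    intro y hy
    have := (hg y hy.1 hy.2).continuousAt
    exact (ContinuousAt.comp (f := fun y : ℝ => ((x:ℂ) + y * I)) this (hlineV x).continuousAt).continuousWithinAt
  -- the three error terms
  set l : ℂ → ℂ := fun w => ε / (exp w - ε) with hl
  have hkl : ∀ w, exp w ≠ ε → exp w / (exp w - ε) = 1 + l w := by
    intro w hw
    have := sub_ne_zero.2 hw
    simp only [hl]; field_simp; ring
  have hld : ∀ w, exp w ≠ ε → DifferentiableAt ℂ l w := by
    intro w hw
    exact (differentiableAt_const _).div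
      (Complex.differentiable_exp.differentiableAt.sub_const _) (sub_ne_zero.2 hw)
  have hsumα : ∑ j ∈ Finset.range n, (α (j+1) - α j) = 2 * Real.pi := by
    rw [Finset.sum_range_sub, hαn]; ring
  -- outer
  have hV : ∀ j < n, ∀ x : ℝ, x < X → ∀ y : ℝ, α j ≤ y → y ≤ α (j+1) → exp (x + y * I) ∈ E j := by
    intro j hj x hx y h1 h2
    exact hmem j hj _ (by simpa using hx) (by simpa using h1) (by simpa using h2)
  have houter : ∀ j < n, ∫ y in (α j)..(α (j+1)), f j (x2 + y * I) =
      (∫ y in (α j)..(α (j+1)), R j (exp (x2 + y * I))) - ((α (j+1) - α j : ℝ) : ℂ) • c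
        + ∫ y in (α j)..(α (j+1)), l (x2 + y * I) • (R j (exp (x2 + y * I)) - c) := by
    intro j hj
    have i1 := intV (fun w => R j (exp w)) x2 j hj (fun y h1 h2 => hRd j _ (hV j hj x2 hx2 y h1 h2))
    have i2 := intV (fun w => l w • (R j (exp w) - c)) x2 j hj
      (fun y h1 h2 => (hld _ (hneV x2 y hx0.ne')).smul ((hRd j _ (hV j hj x2 hx2 y h1 h2)).sub_const c))
    have i3 : IntervalIntegrable (fun _ : ℝ => c) MeasureTheory.volume (α j) (α (j+1)) := intervalIntegrable_const
    have : ((α (j+1) - α j : ℝ) : ℂ) • c = ∫ y in (α j)..(α (j+1)), c := by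
      rw [intervalIntegral.integral_const]; exact (RCLike.real_smul_eq_coe_smul (K := ℂ) _ _).symm
    rw [this, ← intervalIntegral.integral_sub i1 i3, ← intervalIntegral.integral_add (i1.sub i3) i2]
    apply intervalIntegral.integral_congr
    intro y _
    simp only [hf, hkl _ (hneV x2 y hx0.ne'), add_smul, one_smul]
  have hrad : ∀ j < n, (∫ x in x1..x2, f (j+1) (x + α (j+1) * I)) - (∫ x in x1..x2, f j (x + α (j+1) * I)) =
      (∫ x in x1..x2, (R (j+1) (exp (x + α (j+1) * I)) - R j (exp (x + α (j+1) * I)))) +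
      ∫ x in x1..x2, l (x + α (j+1) * I) • (R (j+1) (exp (x + α (j+1) * I)) - R j (exp (x + α (j+1) * I))) := by
    intro j hj
    have m1 : ∀ x : ℝ, x ≤ x2 → exp (x + α (j+1) * I) ∈ E (j+1) := fun x hx => hmemL (j+1) hj x (by linarith)
    have m2 : ∀ x : ℝ, x ≤ x2 → exp (x + α (j+1) * I) ∈ E j := fun x hx => hmemR j hj x (by linarith)
    have i1 := intH (f (j+1)) (α (j+1)) (fun x h1 h2 => hfd _ _ (m1 x h2) (hneR _ hj x))
    have i2 := intH (f j) (α (j+1)) (fun x h1 h2 => hfd _ _ (m2 x h2) (hneR _ hj x))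
    have i3 := intH (fun w => R (j+1) (exp w) - R j (exp w)) (α (j+1))
      (fun x h1 h2 => (hRd _ _ (m1 x h2)).sub (hRd _ _ (m2 x h2)))
    have i4 := intH (fun w => l w • (R (j+1) (exp w) - R j (exp w))) (α (j+1))
      (fun x h1 h2 => (hld _ (hneR _ hj x)).smul ((hRd _ _ (m1 x h2)).sub (hRd _ _ (m2 x h2))))
    rw [← intervalIntegral.integral_sub i1 i2, ← intervalIntegral.integral_add i3 i4]
    apply intervalIntegral.integral_congr
    intro x _
    simp only [hf, hkl _ (hneR (j+1) hj x), add_smul, one_smul, smul_sub]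
    abel
  -- summation
  have hcyc : ∑ j ∈ Finset.range n, (∫ x in x1..x2, f j (x + α j * I)) =
      ∑ j ∈ Finset.range n, (∫ x in x1..x2, f (j+1) (x + α (j+1) * I)) := by
    have h1 := Finset.sum_range_succ' (fun j => ∫ x in x1..x2, f j (x + α j * I)) n
    rw [Finset.sum_range_succ] at h1
    have h2 : (∫ x in x1..x2, f n (x + α n * I)) = ∫ x in x1..x2, f 0 (x + α 0 * I) := by
      apply intervalIntegral.integral_congr
      intro x _
      have : exp (x + (α n : ℂ) * I) = exp (x + α 0 * I) := by
        rw [← Complex.exp_periodic (x + α 0 * I), hαn]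
        congr 1; push_cast; ring
      simp only [hf, this, hRn]
    rw [h2] at h1
    exact add_right_cancel h1
  have hsum := Finset.sum_eq_zero (s := Finset.range n) (fun j hj => hrect j (Finset.mem_range.1 hj))
  rw [Finset.sum_sub_distrib, Finset.sum_add_distrib, Finset.sum_sub_distrib, hcyc, ← Finset.sum_sub_distrib,
    Finset.sum_congr rfl (fun j hj => hrad j (Finset.mem_range.1 hj)), ← Finset.smul_sum, ← Finset.smul_sum,
    Finset.sum_congr rfl (fun j hj => houter j (Finset.mem_range.1 hj)), Finset.sum_add_distrib,
    Finset.sum_add_distrib, Finset.sum_sub_distrib, ← Finset.sum_smul, ← Complex.ofReal_sum, hsumα] at hsum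
  -- bounds
  have b1 : ‖∑ j ∈ Finset.range n, ∫ y in (α j)..(α (j+1)), l (x2 + y * I) • (R j (exp (x2 + y * I)) - c)‖
      ≤ ‖ε‖ * (8 * Real.pi * M / Real.exp x2) := by
    have hb : ∀ j ∈ Finset.range n, ‖∫ y in (α j)..(α (j+1)), l (x2 + y * I) • (R j (exp (x2 + y * I)) - c)‖
        ≤ (2 * ‖ε‖ / Real.exp x2 * (2 * M)) * (α (j+1) - α j) := by
      intro j hj
      have hj := Finset.mem_range.1 hj
      rw [← abs_of_nonneg (sub_nonneg.2 (hα j hj))]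
      apply intervalIntegral.norm_integral_le_of_norm_le_const
      intro y hy
      rw [Set.uIoc_of_le (hα j hj)] at hy
      rw [norm_smul]
      have h1 : ‖l (x2 + y * I)‖ ≤ 2 * ‖ε‖ / Real.exp x2 := by
        simp only [hl, norm_div]
        have h2 : Real.exp x2 / 2 ≤ ‖exp (x2 + y * I) - ε‖ := by
          have := norm_sub_norm_le (exp (x2 + y * I)) ε
          rw [hnorm] at this
          linarith
        have h3 := Real.exp_pos x2
        calc ‖ε‖ / ‖exp (x2 + y * I) - ε‖ ≤ ‖ε‖ / (Real.exp x2 / 2) := by gcongr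
          _ = _ := by field_simp
      have h2 : ‖R j (exp (x2 + y * I)) - c‖ ≤ 2 * M := by
        have := norm_sub_le (R j (exp (x2 + y * I))) c
        have := hM j _ (hV j hj x2 hx2 y hy.1.le hy.2)
        linarith
      gcongr
    refine (norm_sum_le_of_le _ hb).trans ?_
    rw [← Finset.mul_sum, hsumα]
    apply le_of_eq; ring
  have b2 : ‖∑ j ∈ Finset.range n, ∫ x in x1..x2, l (x + α (j+1) * I) • (R (j+1) (exp (x + α (j+1) * I)) - R j (exp (x + α (j+1) * I)))‖
      ≤ ‖ε‖ * (n * K * Real.exp x2 / c0) := by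
    have hb : ∀ j ∈ Finset.range n, ‖∫ x in x1..x2, l (x + α (j+1) * I) • (R (j+1) (exp (x + α (j+1) * I)) - R j (exp (x + α (j+1) * I)))‖
        ≤ ‖ε‖ * (K * Real.exp x2 / c0) := by
      intro j hj
      have hj := Finset.mem_range.1 hj
      have hg : IntervalIntegrable (fun x : ℝ => ‖ε‖ * K / c0 * Real.exp x) MeasureTheory.volume x1 x2 :=
        (by fun_prop : Continuous (fun x : ℝ => ‖ε‖ * K / c0 * Real.exp x)).intervalIntegrable _ _
      refine (intervalIntegral.norm_integral_le_of_norm_le (g := fun x => ‖ε‖ * K / c0 * Real.exp x) hx12 ?_ hg).trans ?_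
      · refine Filter.Eventually.of_forall ?_
        intro x hx
        rw [norm_smul]
        have h0 := Real.exp_pos x
        have h1 : ‖l (x + α (j+1) * I)‖ ≤ ‖ε‖ / (c0 * Real.exp x) := by
          simp only [hl, norm_div]
          have h2 := hsep (j+1) hj x
          rw [hnorm] at h2
          gcongr
        have h2 := hK j hj _ (hmemR j hj x (by linarith [hx.2])) (hmemL (j+1) hj x (by linarith [hx.2]))
        rw [hnorm] at h2
        calc _ ≤ ‖ε‖ / (c0 * Real.exp x) * (K * Real.exp x ^ 2) := by gcongr
          _ = _ := by field_simp
      · rw [intervalIntegral.integral_const_mul, integral_exp]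
        have h3 := Real.exp_pos x1
        calc ‖ε‖ * K / c0 * (Real.exp x2 - Real.exp x1) ≤ ‖ε‖ * K / c0 * (Real.exp x2) := by
              gcongr; linarith
          _ = _ := by ring
    refine (norm_sum_le_of_le _ hb).trans ?_
    rw [Finset.sum_const, Finset.card_range, nsmul_eq_mul]
    apply le_of_eq; ring
  have b3 : ‖∑ j ∈ Finset.range n, ∫ y in (α j)..(α (j+1)), f j (x1 + y * I)‖ ≤ 4 * Real.pi * M * (Real.exp x1 / (‖ε‖ - Real.exp x1)) := by
    have h3 : Real.exp x1 < ‖ε‖ := by rw [hεn]; exact Real.exp_lt_exp.2 hx1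
    have hb : ∀ j ∈ Finset.range n, ‖∫ y in (α j)..(α (j+1)), f j (x1 + y * I)‖
        ≤ (Real.exp x1 / (‖ε‖ - Real.exp x1) * (2 * M)) * (α (j+1) - α j) := by
      intro j hj
      have hj := Finset.mem_range.1 hj
      rw [← abs_of_nonneg (sub_nonneg.2 (hα j hj))]
      apply intervalIntegral.norm_integral_le_of_norm_le_const
      intro y hy
      rw [Set.uIoc_of_le (hα j hj)] at hy
      simp only [hf]
      rw [norm_smul]
      have h1 : ‖exp (x1 + y * I) / (exp (x1 + y * I) - ε)‖ ≤ Real.exp x1 / (‖ε‖ - Real.exp x1) := by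
        rw [norm_div, hnorm]
        have h2 : ‖ε‖ - Real.exp x1 ≤ ‖exp (x1 + y * I) - ε‖ := by
          have := norm_sub_norm_le ε (exp (x1 + y * I))
          rw [hnorm, norm_sub_rev] at this
          linarith
        have h4 : 0 < ‖ε‖ - Real.exp x1 := by linarith
        gcongr
      have h2 : ‖R j (exp (x1 + y * I)) - c‖ ≤ 2 * M := by
        have := norm_sub_le (R j (exp (x1 + y * I))) c
        have := hM j _ (hV j hj x1 (by linarith) y hy.1.le hy.2)
        linarith
      have h4 : 0 ≤ Real.exp x1 / (‖ε‖ - Real.exp x1) := div_nonneg (Real.exp_pos _).le (by linarith)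
      gcongr
    refine (norm_sum_le_of_le _ hb).trans ?_
    rw [← Finset.mul_sum, hsumα]
    apply le_of_eq; ring
  generalize (∑ j ∈ Finset.range n, ∫ y in (α j)..(α (j+1)), l (x2 + y * I) • (R j (exp (x2 + y * I)) - c)) = B1 at *
  generalize (∑ j ∈ Finset.range n, ∫ x in x1..x2, l (x + α (j+1) * I) • (R (j+1) (exp (x + α (j+1) * I)) - R j (exp (x + α (j+1) * I)))) = B2 at *
  generalize (∑ j ∈ Finset.range n, ∫ y in (α j)..(α (j+1)), f j (x1 + y * I)) = B3 at *
  generalize (∑ j ∈ Finset.range n, (∫ y in (α j)..(α (j+1)), R j (exp (x2 + y * I)))) = A1 at *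
  generalize (∑ j ∈ Finset.range n, ∫ x in x1..x2, (R (j+1) (exp (x + α (j+1) * I)) - R j (exp (x + α (j+1) * I)))) = A2 at *
  have e : (2 * Real.pi : ℂ) • c - (A1 - I • A2) = B1 - B3 - I • B2 := by
    have h := congrArg (fun v => (-I) • v) hsum
    simp only [smul_zero, smul_add, smul_sub, smul_smul] at h
    simp at h
    simp only [neg_add_eq_sub] at h
    have hI : I * (I * (2 * (Real.pi : ℂ))) = -(2 * (Real.pi : ℂ)) := by
      rw [← mul_assoc, I_mul_I]; ring
    rw [hI] at h
    rw [← sub_eq_zero]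
    rw [← neg_eq_zero, ← h]
    module
  rw [e]
  calc _ ≤ ‖B1‖ + ‖B3‖ + ‖I • B2‖ := (norm_sub_le _ _).trans (by gcongr; exact norm_sub_le _ _)
    _ ≤ _ := by rw [norm_smul, Complex.norm_I, one_mul]; linarith

set_option maxHeartbeats 1600000 in
open Complex in
lemma cone_lip {F : Type*} [NormedAddCommGroup F] [NormedSpace ℂ F] [CompleteSpace F] {ι : Type*}
    (E : ι → Set ℂ) (R : ι → ℂ → F) (n : ℕ) (hn : 1 ≤ n) (P : ℝ → ι) (X x2 M K c0 : ℝ)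
    (hE : ∀ j, IsOpen (E j)) (hd : ∀ j, DifferentiableOn ℂ (R j) (E j))
    (hP : ∀ (t : ℝ) (w : ℂ), |w.im - t| ≤ Real.pi / n → w.re < X → exp w ∈ E (P t))
    (hM : ∀ j, ∀ z ∈ E j, ‖R j z‖ ≤ M)
    (hK0 : 0 ≤ K)
    (hK : ∀ i j, ∀ z ∈ E i, z ∈ E j → ‖R i z - R j z‖ ≤ K * ‖z‖^2)
    (hx2 : x2 < X) (hc0 : 0 < c0) (hc1 : c0 ≤ 1) (hcos : Real.cos (Real.pi / (2 * n)) ≤ 1 - 2 * c0)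
    (t0 : ℝ) (w v : ℂ) (hw : |w.im - t0| ≤ Real.pi / (2 * n)) (hv : |v.im - t0| ≤ Real.pi / (2 * n))
    (hw' : ‖exp w‖ ≤ Real.exp x2 / 2) (hv' : ‖exp v‖ ≤ Real.exp x2 / 2) :
    ‖R (P t0) (exp w) - R (P t0) (exp v)‖ ≤
      (8 * Real.pi * M / Real.exp x2 + n * K * Real.exp x2 / c0) * (‖exp w‖ + ‖exp v‖) := by
  have hn0 : (0:ℝ) < n := by exact_mod_cast hn
  have hn1 : (1:ℝ) ≤ n := by exact_mod_cast hn
  obtain ⟨h, hh⟩ : ∃ h : ℝ, h = Real.pi / (2 * n) := ⟨_, rfl⟩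
  have hhn : 2 * n * h = Real.pi := by rw [hh]; field_simp
  have hh2 : Real.pi / n = 2 * h := by rw [hh]; field_simp
  have hpi := Real.pi_pos
  have hhpos : 0 < h := by rw [hh]; positivity
  have hhle : h ≤ Real.pi := by nlinarith
  rw [← hh] at hw hv hcos
  rw [hh2] at hP
  set α : ℕ → ℝ := fun j => t0 - 2 * h + j * (4 * h) with hα
  set pp : ℕ → ι := fun j => P (t0 + ((j % n : ℕ) : ℝ) * (4 * h)) with hpp
  have hpp0 : pp 0 = P t0 := by simp [hpp]
  have hppn : pp n = pp 0 := by simp [hpp]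
  have sepgen : ∀ w0 z : ℂ, h ≤ z.im - w0.im → z.im - w0.im ≤ 2 * Real.pi - h →
      c0 * ‖exp z‖ ≤ ‖exp z - exp w0‖ := by
    intro w0 z h1 h2
    have e : exp z - exp w0 = exp z * (1 - exp (w0 - z)) := by
      rw [mul_sub, ← exp_add]; simp
    rw [e, norm_mul, mul_comm]
    gcongr
    apply one_sub_exp_lower _ _ _ hc0.le hc1
    rw [sub_im, ← Real.cos_neg, neg_sub]
    exact (cos_le_of_mem h _ hhpos.le hhle h1 h2).trans hcos
  have sepgen' : ∀ w0 z : ℂ, h ≤ w0.im - z.im → w0.im - z.im ≤ 2 * Real.pi - h →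
      c0 * ‖exp z‖ ≤ ‖exp z - exp w0‖ := by
    intro w0 z h1 h2
    have e : exp z - exp w0 = exp z * (1 - exp (w0 - z)) := by
      rw [mul_sub, ← exp_add]; simp
    rw [e, norm_mul, mul_comm]
    gcongr
    apply one_sub_exp_lower _ _ _ hc0.le hc1
    rw [sub_im]
    exact (cos_le_of_mem h _ hhpos.le hhle h1 h2).trans hcos
  have main : ∀ x1 : ℝ, ∀ w0 : ℂ, |w0.im - t0| ≤ h → ‖exp w0‖ ≤ Real.exp x2 / 2 → x1 < w0.re → _ :=
    fun x1 w0 h1 h2 h3 => cone_abs (fun j => E (pp j)) (fun j => R (pp j)) n hn α X x1 x2 M K c0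
      (by intro j _; simp only [hα]; push_cast; linarith)
      (by simp only [hα]; push_cast; nlinarith)
      (fun j => hE _) (fun j => hd _)
      (by
        intro j hj z hz h4 h5
        apply hP _ _ _ hz
        rw [Nat.mod_eq_of_lt hj]
        simp only [hα] at h4 h5
        push_cast at h5
        rw [abs_le]; constructor <;> linarith)
      (by simp only [hppn]) (by simp only [hppn])
      (fun j => hM _) hK0
      (fun j _ z hz hz' => hK _ _ z hz' hz) hx2 hc0 w0
      (by rw [abs_le] at h1; simp only [hα]; push_cast; linarith)
      (by rw [abs_le] at h1; simp only [hα]; push_cast; linarith)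
      h2 h3
      (by
        intro j hj x
        rw [abs_le] at h1
        have hjn : (j:ℝ) ≤ n := by exact_mod_cast hj
        rcases Nat.eq_zero_or_pos j with h0 | h0
        · subst h0
          apply sepgen'
          · simp [hα]; linarith
          · simp [hα]; nlinarith
        · have hj1 : (1:ℝ) ≤ j := by exact_mod_cast h0
          apply sepgen
          · simp [hα]; nlinarith
          · simp [hα]; nlinarith)
      (by
        intro j hj h0 z h4 h5 heq
        rw [abs_le] at h1
        have hjn : (j:ℝ) + 1 ≤ n := by exact_mod_cast hj
        have hj1 : (1:ℝ) ≤ j := by exact_mod_cast h0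
        simp only [hα] at h4 h5
        push_cast at h5
        have := sepgen w0 z (by nlinarith) (by nlinarith)
        rw [heq, sub_self, norm_zero] at this
        have h6 : 0 < ‖exp w0‖ := norm_pos_iff.2 (exp_ne_zero _)
        nlinarith)
  simp only [hpp0] at main
  set L := 8 * Real.pi * M / Real.exp x2 + n * K * Real.exp x2 / c0 with hL
  have key : ∀ x1 : ℝ, x1 < w.re → x1 < v.re → ‖R (P t0) (exp w) - R (P t0) (exp v)‖ ≤
      L * (‖exp w‖ + ‖exp v‖) + (4 * Real.pi * M * (Real.exp x1 / (‖exp w‖ - Real.exp x1))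
        + 4 * Real.pi * M * (Real.exp x1 / (‖exp v‖ - Real.exp x1))) := by
    intro x1 h1 h2
    have m1 := main x1 w hw hw' h1
    have m2 := main x1 v hv hv' h2
    have m3 := norm_sub_le_of_le m1 m2
    rw [sub_sub_sub_cancel_right, ← smul_sub, norm_smul] at m3
    have h3 : (1:ℝ) ≤ ‖(2 * Real.pi : ℂ)‖ := by
      simp [abs_of_pos hpi]
      linarith [Real.pi_gt_three]
    have := norm_nonneg (R (P t0) (exp w) - R (P t0) (exp v))
    nlinarith
  have lim : ∀ b : ℝ, 0 < b → Filter.Tendsto (fun x1 => 4 * Real.pi * M * (Real.exp x1 / (b - Real.exp x1)))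
      Filter.atBot (nhds 0) := by
    intro b hb
    have h1 := Real.tendsto_exp_atBot
    have := (h1.div (tendsto_const_nhds (x := b) |>.sub h1) (by simpa using hb.ne')).const_mul (4 * Real.pi * M)
    simpa using this
  have hwp : 0 < ‖exp w‖ := norm_pos_iff.2 (exp_ne_zero _)
  have hvp : 0 < ‖exp v‖ := norm_pos_iff.2 (exp_ne_zero _)
  have lim2 := ((lim _ hwp).add (lim _ hvp)).const_add (L * (‖exp w‖ + ‖exp v‖))
  rw [add_zero, add_zero] at lim2
  refine ge_of_tendsto lim2 ?_
  filter_upwards [Filter.Iio_mem_atBot w.re, Filter.Iio_mem_atBot v.re] with x h1 h2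
  exact key x h1 h2

set_option maxHeartbeats 1600000 in
open Complex in
lemma rs_step (F : Type*) [NormedAddCommGroup F] [NormedSpace ℂ F] [CompleteSpace F] {ι : Type*}
    (E : ι → Set ℂ) (n : ℕ) (hn : 1 ≤ n) (P : ℝ → ι) (e0 : ℝ) (he0 : 0 < e0)
    (hE : ∀ j, IsOpen (E j))
    (hsub : ∀ j, ∀ z ∈ E j, z ≠ 0 ∧ ‖z‖ < e0)
    (hP : ∀ (t : ℝ) (w : ℂ), |w.im - t| ≤ Real.pi / n → w.re < Real.log e0 → exp w ∈ E (P t)) :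
    ∃ C : ℝ, 0 < C ∧ ∀ (R : ι → ℂ → F) (M K : ℝ), 0 ≤ K →
      (∀ j, DifferentiableOn ℂ (R j) (E j)) →
      (∀ j, ∀ z ∈ E j, ‖R j z‖ ≤ M) →
      (∀ i j, ∀ z ∈ E i, z ∈ E j → ‖R i z - R j z‖ ≤ K * ‖z‖^2) →
      ∃ a : F, ∀ j, ∀ z ∈ E j, ‖R j z - a‖ ≤ C * (M + K) * ‖z‖ := by
  have hn0 : (0:ℝ) < n := by exact_mod_cast hn
  have hn1 : (1:ℝ) ≤ n := by exact_mod_cast hn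
  have hpi := Real.pi_pos
  obtain ⟨h, hh⟩ : ∃ h : ℝ, h = Real.pi / (2 * n) := ⟨_, rfl⟩
  have hhn : 2 * n * h = Real.pi := by rw [hh]; field_simp
  have hh2 : Real.pi / n = 2 * h := by rw [hh]; field_simp
  have hhpos : 0 < h := by rw [hh]; positivity
  have hhle : h ≤ Real.pi := by nlinarith
  obtain ⟨c0, hc⟩ : ∃ c0 : ℝ, c0 = (1 - Real.cos h) / 2 := ⟨_, rfl⟩
  have hc0 : 0 < c0 := by
    have := Real.cos_lt_cos_of_nonneg_of_le_pi le_rfl hhle hhpos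
    rw [Real.cos_zero] at this
    rw [hc]; linarith
  have hc1 : c0 ≤ 1 := by
    have := Real.neg_one_le_cos h
    rw [hc]; linarith
  set D : ℝ := 16 * Real.pi / e0 + n * e0 / c0 + e0 with hD
  have hDpos : 0 < D := by positivity
  refine ⟨(4 * n + 1) * D + e0 + 8 / e0, by positivity, ?_⟩
  intro R M K hK0 hd hM hK
  have hP' := hP
  rw [hh2] at hP'
  set X := Real.log e0 with hX
  set x2 := Real.log (e0 / 2) with hx2
  have hex2 : Real.exp x2 = e0 / 2 := Real.exp_log (by positivity)
  have hx2X : x2 < X := Real.log_lt_log (by positivity) (by linarith)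
  set Y := Real.log (e0 / 4) with hY
  have heY : Real.exp Y = e0 / 4 := Real.exp_log (by positivity)
  have hYX : Y < X := Real.log_lt_log (by positivity) (by linarith)
  have hexY : ∀ x ≤ Y, Real.exp x ≤ e0 / 4 := fun x hx => heY ▸ Real.exp_le_exp.2 hx
  have hnorm : ∀ x y : ℝ, ‖exp (x + y * I)‖ = Real.exp x := by
    intro x y; rw [Complex.norm_exp]; simp
  have hmem : ∀ t t' x : ℝ, |t' - t| ≤ 2 * h → x ≤ Y → exp (x + t' * I) ∈ E (P t) := by
    intro t t' x h1 h2
    exact hP' t _ (by simpa using h1) (by simp; linarith)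
  have hM0 : 0 ≤ M := (norm_nonneg _).trans (hM _ _ (hmem 0 0 Y (by simp; linarith) le_rfl))
  set u : ℝ → ℝ → F := fun x t => R (P t) (exp (x + t * I)) with hu
  have near : ∀ t t' x x' : ℝ, |t' - t| ≤ h → x ≤ Y → x' ≤ Y →
      ‖u x t - u x' t'‖ ≤ D * (M + K) * (Real.exp x + Real.exp x') := by
    intro t t' x x' ht hx hx'
    have h1 := cone_lip E R n hn P X x2 M K c0 hE hd hP hM hK0 hK hx2X hc0 hc1 (by rw [← hh, hc]; linarith)
      t (x + t * I) (x' + t' * I) (by simp; positivity) (by rw [← hh]; simpa using ht)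
      (by rw [hnorm, hex2]; linarith [hexY x hx]) (by rw [hnorm, hex2]; linarith [hexY x' hx'])
    have h2 := hK (P t) (P t') (exp (x' + t' * I)) (hmem _ _ _ (by linarith) hx') (hmem _ _ _ (by simp; linarith) hx')
    rw [hnorm, hnorm, hex2] at h1
    rw [hnorm] at h2
    have h3 := norm_sub_le_norm_sub_add_norm_sub (u x t) (R (P t) (exp (x' + t' * I))) (u x' t')
    have ex := Real.exp_pos x
    have ex' := Real.exp_pos x'
    have h4 : Real.exp x' ^ 2 ≤ e0 * (Real.exp x + Real.exp x') := by
      nlinarith [hexY x' hx']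
    have h5 : K * Real.exp x' ^ 2 ≤ K * (e0 * (Real.exp x + Real.exp x')) := by gcongr
    have h6 : 8 * Real.pi * M / (e0 / 2) + n * K * (e0 / 2) / c0 + K * e0 ≤ D * (M + K) := by
      have e1 : 8 * Real.pi * M / (e0 / 2) = 16 * Real.pi / e0 * M := by field_simp; ring
      have e2 : n * K * (e0 / 2) / c0 = n * e0 / c0 * K / 2 := by field_simp
      rw [e1, e2, hD]
      have g1 : 0 ≤ 16 * Real.pi / e0 * K := by positivity
      have g2 : 0 ≤ n * e0 / c0 * M := by positivity
      have g3 : 0 ≤ n * e0 / c0 * K := by positivity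
      have g4 : 0 ≤ e0 * M := by positivity
      nlinarith
    calc _ ≤ _ := h3
      _ ≤ (8 * Real.pi * M / (e0 / 2) + n * K * (e0 / 2) / c0 + K * e0) * (Real.exp x + Real.exp x') := by
        nlinarith
      _ ≤ _ := by gcongr
  set L := D * (M + K) with hL
  have hL0 : 0 ≤ L := by positivity
  have hlimexp : Filter.Tendsto (fun m : ℕ => Real.exp (Y - m)) Filter.atTop (nhds 0) := by
    apply Real.tendsto_exp_atBot.comp
    apply Filter.tendsto_atBot_add_const_left _ Y
    exact Filter.tendsto_neg_atTop_atBot.comp tendsto_natCast_atTop_atTop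
  have hcau : CauchySeq (fun m : ℕ => u (Y - m) 0) := by
    apply cauchySeq_of_le_tendsto_0 (fun m : ℕ => L * (Real.exp (Y - m) + Real.exp (Y - m)))
    · intro m m' N h1 h2
      rw [dist_eq_norm]
      have h1' : (N:ℝ) ≤ m := by exact_mod_cast h1
      have h2' : (N:ℝ) ≤ m' := by exact_mod_cast h2
      have hNn : (0:ℝ) ≤ N := by positivity
      refine (near 0 0 _ _ (by simp; linarith) (by linarith) (by linarith)).trans ?_
      gcongr
    · simpa using (hlimexp.add hlimexp).const_mul L
  obtain ⟨a, ha⟩ := cauchySeq_tendsto_of_complete hcau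
  have haM : ‖a‖ ≤ M := by
    refine le_of_tendsto ha.norm (Filter.Eventually.of_forall fun m => ?_)
    exact hM _ _ (hmem _ _ _ (by simp; linarith) (by have : (0:ℝ) ≤ m := by positivity
                                                     linarith))
  have base : ∀ x ≤ Y, ‖u x 0 - a‖ ≤ L * Real.exp x := by
    intro x hx
    have h1 := (tendsto_const_nhds (x := u x 0)).sub ha |>.norm
    have h2 := (hlimexp.const_add (Real.exp x)).const_mul L
    rw [add_zero] at h2
    refine le_of_tendsto_of_tendsto' h1 h2 fun m => ?_
    have : (0:ℝ) ≤ m := by positivity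
    exact near 0 0 _ _ (by simp; linarith) hx (by linarith)
  have chain : ∀ m : ℕ, ∀ t x : ℝ, |t| ≤ m * h → x ≤ Y → ‖u x t - a‖ ≤ (2 * m + 1) * (L * Real.exp x) := by
    intro m
    induction m with
    | zero =>
      intro t x ht hx
      have : t = 0 := by simpa using ht
      subst this
      simpa using base x hx
    | succ m ih =>
      intro t x ht hx
      push_cast at ht ⊢
      have hm : (0:ℝ) < m + 1 := by positivity
      have h1 := ih (t * (m / (m + 1))) x (by
        rw [abs_mul, abs_of_nonneg (by positivity : (0:ℝ) ≤ m / (m + 1))]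
        calc |t| * (m / (m+1)) ≤ ((m + 1) * h) * (m / (m+1)) := by gcongr
          _ = _ := by field_simp) hx
      have h2 := near t (t * (m / (m + 1))) x x (by
        have : t * (m / (m + 1)) - t = - t * (1 / (m + 1)) := by field_simp; ring
        rw [this, abs_mul, abs_neg, abs_of_pos (by positivity : (0:ℝ) < 1 / (m + 1))]
        calc |t| * (1 / (m+1)) ≤ ((m + 1) * h) * (1 / (m+1)) := by gcongr
          _ = _ := by field_simp) hx hx
      have h3 := norm_sub_le_norm_sub_add_norm_sub (u x t) (u x (t * (m / (m + 1)))) a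
      linarith
  refine ⟨a, ?_⟩
  intro j z hz
  obtain ⟨hz0, hze⟩ := hsub j z hz
  have hzp : 0 < ‖z‖ := norm_pos_iff.2 hz0
  have hMK : 0 ≤ M + K := by linarith
  rcases le_total ‖z‖ (e0 / 4) with hs | hs
  · have hzx : exp ((Real.log ‖z‖ : ℝ) + (arg z : ℝ) * I) = z := by
      have := Complex.exp_log hz0
      rwa [Complex.log] at this
    have hxY : Real.log ‖z‖ ≤ Y := Real.log_le_log hzp hs
    have h1 := chain (2 * n) (arg z) (Real.log ‖z‖) (by push_cast; rw [hhn]; exact abs_arg_le_pi z) hxY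
    have hzE : z ∈ E (P (arg z)) := by
      have := hmem (arg z) (arg z) (Real.log ‖z‖) (by simp; linarith) hxY
      rwa [hzx] at this
    have h2 := hK j (P (arg z)) z hz hzE
    rw [Real.exp_log hzp] at h1
    simp only [hu, hzx] at h1
    have h3 := norm_sub_le_norm_sub_add_norm_sub (R j z) (R (P (arg z)) z) a
    push_cast at h1
    have h4 : K * ‖z‖^2 ≤ e0 * (M + K) * ‖z‖ := by
      have : K * ‖z‖^2 ≤ K * (e0 * ‖z‖) := by gcongr; nlinarith
      have : 0 ≤ M * (e0 * ‖z‖) := by positivity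
      nlinarith
    have h5 : 0 ≤ 8 / e0 * (M + K) * ‖z‖ := by positivity
    calc _ ≤ _ := h3
      _ ≤ e0 * (M + K) * ‖z‖ + (2 * (2 * n) + 1) * (L * ‖z‖) + 8 / e0 * (M + K) * ‖z‖ := by linarith
      _ = _ := by rw [hL]; ring
  · have h1 := norm_sub_le (R j z) a
    have h2 := hM j z hz
    have h3 : 2 * M ≤ 8 / e0 * (M + K) * ‖z‖ := by
      calc 2 * M ≤ 2 * (M + K) := by linarith
        _ = 8 / e0 * (M + K) * (e0 / 4) := by field_simp; ring
        _ ≤ _ := by gcongr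
    have h4 : 0 ≤ ((4 * n + 1) * D + e0) * (M + K) * ‖z‖ := by positivity
    calc _ ≤ 8 / e0 * (M + K) * ‖z‖ + ((4 * n + 1) * D + e0) * (M + K) * ‖z‖ := by linarith
      _ = _ := by ring

lemma flat_bound (q : ℝ) (hq : 1 < q) (k : ℕ) (hk : 1 ≤ k) (C1 C2 : ℝ) (hC2 : 0 < C2) (N : ℕ) (r : ℝ) (hr : 0 < r) :
    C2 * r ^ C1 * Real.exp (-((k : ℝ) / (2 * Real.log q)) * (Real.log r) ^ 2) ≤
      (C2 * q ^ ((2 - C1)^2 / (2 * k) : ℝ)) * (q ^ ((3 - 2 * C1) / (2 * k) : ℝ)) ^ N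
        * q ^ (((N:ℝ) + 1) * N / (2 * k)) * r ^ (N + 2) := by
  have hq0 : 0 < q := by linarith
  have hl : 0 < Real.log q := Real.log_pos hq
  have hk0 : (0:ℝ) < k := by exact_mod_cast hk
  have hrN : r ^ (N + 2) = Real.exp (Real.log r * (N + 2)) := by
    rw [← Real.rpow_natCast, Real.rpow_def_of_pos hr]; push_cast; rfl
  rw [hrN, ← Real.rpow_mul_natCast hq0.le, Real.rpow_def_of_pos hr, Real.rpow_def_of_pos hq0,
    Real.rpow_def_of_pos hq0, Real.rpow_def_of_pos hq0]
  simp only [mul_assoc]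
  rw [← Real.exp_add, ← Real.exp_add, ← Real.exp_add, ← Real.exp_add]
  refine mul_le_mul_of_nonneg_left (Real.exp_le_exp.2 ?_) hC2.le
  generalize Real.log r = x
  generalize Real.log q = l at *
  rw [← sub_nonneg]
  have : (l * ((2 - C1)^2 / (2 * k)) + (l * ((3 - 2 * C1) / (2 * k) * N) + (l * (((N:ℝ) + 1) * N / (2 * k)) + x * (N + 2))) - (x * C1 + -(k / (2 * l)) * x ^ 2))
    = (l * (N + 2 - C1) + k * x)^2 / (2 * k * l) := by
    field_simp; ring
  rw [this]
  positivity

lemma rs_induct {F : Type*} [NormedAddCommGroup F] [NormedSpace ℂ F] {ι : Type*}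
    (E : ι → Set ℂ) (hsub : ∀ j, ∀ z ∈ E j, z ≠ 0) (q : ℝ) (hq : 1 < q) (k : ℕ) (hk : 1 ≤ k) (C : ℝ) (hC : 0 < C)
    (hstep : ∀ (R : ι → ℂ → F) (M K : ℝ), 0 ≤ K →
      (∀ j, DifferentiableOn ℂ (R j) (E j)) →
      (∀ j, ∀ z ∈ E j, ‖R j z‖ ≤ M) →
      (∀ i j, ∀ z ∈ E i, z ∈ E j → ‖R i z - R j z‖ ≤ K * ‖z‖^2) →
      ∃ a : F, ∀ j, ∀ z ∈ E j, ‖R j z - a‖ ≤ C * (M + K) * ‖z‖)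
    (G : ι → ℂ → F) (hG : ∀ j, DifferentiableOn ℂ (G j) (E j)) (M0 D B : ℝ) (hD : 0 < D) (hB : 0 < B)
    (hM : ∀ j, ∀ z ∈ E j, ‖G j z‖ ≤ M0)
    (hΔ : ∀ i j, ∀ z ∈ E i, z ∈ E j → ∀ N : ℕ, ‖G i z - G j z‖ ≤
      D * B ^ N * q ^ (((N:ℝ) + 1) * N / (2 * k)) * ‖z‖ ^ (N + 2)) :
    ∃ fn : ℕ → F, ∃ A D' : ℝ, 0 < A ∧ 0 < D' ∧ ∀ j, ∀ N : ℕ, ∀ z ∈ E j,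
      ‖G j z - ∑ n ∈ Finset.range (N + 1), z ^ n • fn n‖
          ≤ D' * A ^ (N + 1) * q ^ (((N : ℝ) + 1) * N / (2 * k)) * ‖z‖ ^ (N + 1) := by
  have hk0 : (0:ℝ) < k := by exact_mod_cast hk
  have hq0 : 0 < q := by linarith
  obtain ⟨W, hW⟩ : ∃ W : ℕ → ℝ, W = fun N : ℕ => q ^ ((N:ℝ) * (N - 1) / (2 * k)) := ⟨_, rfl⟩
  have hWpos : ∀ N, 0 < W N := fun N => by rw [hW]; exact Real.rpow_pos_of_pos hq0 _
  have hWs : ∀ N : ℕ, W (N + 1) = q ^ (((N:ℝ) + 1) * N / (2 * k)) := by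
    intro N; rw [hW]; push_cast; simp
  have hWm : ∀ N, W N ≤ W (N + 1) := by
    intro N; rw [hWs, hW]
    apply Real.rpow_le_rpow_of_exponent_le hq.le
    have : (0:ℝ) ≤ N := by positivity
    exact div_le_div_of_nonneg_right (by nlinarith) (by positivity)
  simp only [← hWs] at hΔ ⊢
  obtain ⟨A, hA⟩ : ∃ A, A = B + 2 * C := ⟨_, rfl⟩
  obtain ⟨D', hD'⟩ : ∃ D', D' = D + |M0| := ⟨_, rfl⟩
  have hApos : 0 < A := by rw [hA]; positivity
  have hDpos : 0 < D' := by rw [hD']; positivity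
  let Good : ℕ → (ℂ → F) → Prop := fun N S => Differentiable ℂ S ∧
    ∀ j, ∀ z ∈ E j, ‖G j z - S z‖ ≤ D' * A ^ N * W N * ‖z‖ ^ N
  have nx : ∀ N S, ∃ a : F, Good N S → Good (N + 1) (fun z => S z + z ^ N • a) := by
    intro N S
    by_cases hg : Good N S
    swap
    · exact ⟨0, fun h => absurd h hg⟩
    obtain ⟨hSd, hSb⟩ := hg
    obtain ⟨a, ha⟩ := hstep (fun j z => (z ^ N)⁻¹ • (G j z - S z)) (D' * A ^ N * W N)
      (D * B ^ N * W (N + 1)) (by have := hWpos (N+1); positivity)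
      (by
        intro j z hz
        apply DifferentiableWithinAt.smul
        · exact ((differentiableAt_id.pow N).inv (pow_ne_zero _ (hsub j z hz))).differentiableWithinAt
        · exact ((hG j) z hz).sub (hSd z).differentiableWithinAt)
      (by
        intro j z hz
        have hz0 : 0 < ‖z‖ := norm_pos_iff.2 (hsub j z hz)
        rw [norm_smul, norm_inv, norm_pow, inv_mul_le_iff₀ (by positivity), mul_comm]
        exact hSb j z hz)
      (by
        intro i j z hi hj
        have hz0 : 0 < ‖z‖ := norm_pos_iff.2 (hsub j z hj)
        rw [← smul_sub, sub_sub_sub_cancel_right, norm_smul, norm_inv, norm_pow, inv_mul_le_iff₀ (by positivity)]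
        refine (hΔ i j z hi hj N).trans (le_of_eq ?_)
        rw [pow_add]; ring)
    refine ⟨a, fun _ => ⟨by fun_prop, ?_⟩⟩
    intro j z hz
    have hz0 : 0 < ‖z‖ := norm_pos_iff.2 (hsub j z hz)
    have h1 := ha j z hz
    have e : G j z - (S z + z ^ N • a) = z ^ N • ((z ^ N)⁻¹ • (G j z - S z) - a) := by
      rw [smul_sub, smul_smul, mul_inv_cancel₀ (pow_ne_zero _ (hsub j z hz)), one_smul]; abel
    rw [e, norm_smul, norm_pow]
    have h2 : C * (D' * A ^ N * W N + D * B ^ N * W (N + 1)) ≤ D' * A ^ (N + 1) * W (N + 1) := by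
      have w1 := hWpos (N + 1)
      have w0 := hWpos N
      have hBA : B ^ N ≤ A ^ N := pow_le_pow_left₀ hB.le (by rw [hA]; linarith) _
      have hDD : D ≤ D' := by rw [hD']; linarith [abs_nonneg M0]
      calc C * (D' * A ^ N * W N + D * B ^ N * W (N + 1))
          ≤ C * (D' * A ^ N * W (N + 1) + D' * A ^ N * W (N + 1)) := by
            gcongr
            exact hWm N
        _ = D' * A ^ N * (2 * C) * W (N + 1) := by ring
        _ ≤ D' * A ^ N * A * W (N + 1) := by gcongr; rw [hA]; linarith
        _ = _ := by ring
    calc ‖z‖ ^ N * ‖(z ^ N)⁻¹ • (G j z - S z) - a‖ ≤ ‖z‖ ^ N * (C * (D' * A ^ N * W N + D * B ^ N * W (N + 1)) * ‖z‖) := by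
          gcongr
      _ ≤ ‖z‖ ^ N * (D' * A ^ (N + 1) * W (N + 1) * ‖z‖) := by gcongr
      _ = _ := by ring
  choose nxt hnxt using nx
  let S : ℕ → ℂ → F := fun N => Nat.rec (fun _ => 0) (fun N S z => S z + z ^ N • nxt N S) N
  have hSs : ∀ N, S (N + 1) = fun z => S N z + z ^ N • nxt N (S N) := fun N => rfl
  have hgood : ∀ N, Good N (S N) := by
    intro N
    induction N with
    | zero =>
      refine ⟨differentiable_const _, ?_⟩
      intro j z hz
      have h1 : W 0 = 1 := by rw [hW]; simp
      have h2 := hM j z hz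
      have h3 : S 0 z = 0 := rfl
      rw [h3, h1]
      simp
      rw [hD']
      linarith [le_abs_self M0]
    | succ N ih => rw [hSs]; exact hnxt N _ ih
  have hSsum : ∀ N z, S N z = ∑ n ∈ Finset.range N, z ^ n • nxt n (S n) := by
    intro N z
    induction N with
    | zero => rfl
    | succ N ih => rw [Finset.sum_range_succ, ← ih, hSs]
  refine ⟨fun n => nxt n (S n), A, D', hApos, hDpos, ?_⟩
  intro j N z hz
  rw [← hSsum]
  exact (hgood (N + 1)).2 j z hz

open Complex in
lemma mem_sector (θ1 θ2 r : ℝ) (hr : 0 < r) (w : ℂ) :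
    exp w ∈ planarSector θ1 θ2 r ↔
      w.re < Real.log r ∧ ∃ m : ℤ, θ1 < w.im + m * (2 * Real.pi) ∧ w.im + m * (2 * Real.pi) < θ2 := by
  constructor
  · rintro ⟨ρ, θ, h1, h2, h3, h4, h5⟩
    have hρ : exp w = exp (Real.log ρ + θ * I) := by
      rw [h5, exp_add, ← ofReal_exp, Real.exp_log h1]
    obtain ⟨m, hm⟩ := Complex.exp_eq_exp_iff_exists_int.1 hρ
    have hre := congrArg re hm
    have him := congrArg im hm
    simp at hre him
    refine ⟨by rw [hre]; exact Real.log_lt_log h1 h2, -m, ?_⟩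
    push_cast
    rw [him]
    constructor <;> linarith
  · rintro ⟨h1, m, h2, h3⟩
    refine ⟨Real.exp w.re, w.im + m * (2 * Real.pi), Real.exp_pos _, ?_, h2, h3, ?_⟩
    · rw [← Real.exp_log hr]; exact Real.exp_lt_exp.2 h1
    · rw [ofReal_exp, ← exp_add, Complex.exp_eq_exp_iff_exists_int]
      refine ⟨-m, ?_⟩
      apply Complex.ext <;> simp

open Complex in
lemma sector_open (θ1 θ2 r : ℝ) (hr : 0 < r) : IsOpen (planarSector θ1 θ2 r) := by
  have : planarSector θ1 θ2 r = exp '' {w | w.re < Real.log r ∧ θ1 < w.im ∧ w.im < θ2} := by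
    ext z
    constructor
    · rintro ⟨ρ, θ, h1, h2, h3, h4, h5⟩
      refine ⟨Real.log ρ + θ * I, ⟨by simpa using Real.log_lt_log h1 h2, by simpa using h3, by simpa using h4⟩, ?_⟩
      rw [h5, exp_add, ← ofReal_exp, Real.exp_log h1]
    · rintro ⟨w, ⟨h1, h2, h3⟩, rfl⟩
      exact (mem_sector _ _ _ hr _).2 ⟨h1, 0, by simpa using h2, by simpa using h3⟩
  rw [this]
  apply Complex.isOpenMap_exp
  exact (isOpen_lt continuous_re continuous_const).inter
    ((isOpen_lt continuous_const continuous_im).inter (isOpen_lt continuous_im continuous_const))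

def angT (a b : ℝ) : Set ℝ := {t | ∃ m : ℤ, a < t + m * (2 * Real.pi) ∧ t + m * (2 * Real.pi) < b}

lemma angT_open (a b : ℝ) : IsOpen (angT a b) := by
  have : angT a b = ⋃ m : ℤ, (fun t : ℝ => t + m * (2 * Real.pi)) ⁻¹' Set.Ioo a b := by
    ext t; simp only [angT, Set.mem_iUnion, Set.mem_preimage, Set.mem_Ioo, Set.mem_setOf_eq]
  rw [this]
  exact isOpen_iUnion fun m => isOpen_Ioo.preimage (by fun_prop)

lemma angT_shift (a b t : ℝ) (m : ℤ) (h : t + m * (2 * Real.pi) ∈ angT a b) : t ∈ angT a b := by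
  obtain ⟨l, hl⟩ := h
  refine ⟨m + l, ?_⟩
  push_cast
  constructor <;> linarith

lemma angT_shift' (a b t : ℝ) (m : ℤ) (h : t ∈ angT a b) : t + m * (2 * Real.pi) ∈ angT a b := by
  apply angT_shift a b _ (-m)
  push_cast
  rwa [add_assoc, ← add_mul, add_neg_cancel, zero_mul, add_zero]

lemma adj_of_meet (ς : ℕ) (hς : 2 ≤ ς) (a b : ℕ → ℝ) (hab : ∀ p < ς, a p < b p)
    (h2 : ∀ p < ς, ∃ t, t ∈ angT (a p) (b p) ∧ t ∈ angT (a ((p+1) % ς)) (b ((p+1) % ς)))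
    (h3 : ∀ p1 < ς, ∀ p2 < ς, ∀ p3 < ς, p1 ≠ p2 → p1 ≠ p3 → p2 ≠ p3 → ∀ t,
      t ∈ angT (a p1) (b p1) → t ∈ angT (a p2) (b p2) → t ∈ angT (a p3) (b p3) → False)
    (i j : ℕ) (hi : i < ς) (hj : j < ς) (hij : i ≠ j) (t : ℝ) (hti : t ∈ angT (a i) (b i)) (htj : t ∈ angT (a j) (b j)) :
    j = (i + 1) % ς ∨ i = (j + 1) % ς := by
  obtain ⟨s, hs⟩ : ∃ s : ℕ → ℕ, s = fun p => (p + 1) % ς := ⟨_, rfl⟩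
  have hs' : ∀ p, (p + 1) % ς = s p := fun p => by rw [hs]
  have hsp : ∀ p < ς, (p + 1 < ς ∧ s p = p + 1) ∨ (p + 1 = ς ∧ s p = 0) := by
    intro p hp
    rcases Nat.lt_or_ge (p + 1) ς with h | h
    · left; exact ⟨h, by rw [hs]; exact Nat.mod_eq_of_lt h⟩
    · right
      have : p + 1 = ς := by omega
      exact ⟨this, by rw [hs]; simp [this]⟩
  have hpr : ∀ p < ς, ∃ m < ς, s m = p := by
    intro p hp
    rcases Nat.eq_zero_or_pos p with h | h
    · refine ⟨ς - 1, by omega, ?_⟩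
      have := hsp (ς - 1) (by omega)
      omega
    · refine ⟨p - 1, by omega, ?_⟩
      have := hsp (p - 1) (by omega)
      omega
  simp only [hs'] at h2 ⊢
  by_contra hcon
  push Not at hcon
  have hsi := hsp i hi
  have hsj := hsp j hj
  have hς3 : 3 ≤ ς := by omega
  have endpt : ∀ m < ς, m ≠ i → (∃ t, t ∈ angT (a i) (b i) ∧ t ∈ angT (a m) (b m)) →
      a i ∈ angT (a m) (b m) ∨ b i ∈ angT (a m) (b m) := by
    rintro m hm hmi ⟨t, ⟨l, hl1, hl2⟩, htm⟩
    obtain ⟨r, hr1, hr2⟩ := angT_shift' _ _ _ l htm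
    by_contra hno
    rw [not_or] at hno
    obtain ⟨n1, n2⟩ := hno
    have g1 : a i + r * (2 * Real.pi) ≤ a m := by
      by_contra hlt
      exact n1 ⟨r, by linarith, by linarith⟩
    have g2 : b m ≤ b i + r * (2 * Real.pi) := by
      by_contra hlt
      exact n2 ⟨r, by linarith, by linarith⟩
    have sub : ∀ x, x ∈ angT (a m) (b m) → x ∈ angT (a i) (b i) := by
      rintro x ⟨y, hy1, hy2⟩
      refine ⟨y - r, ?_⟩
      push_cast
      constructor <;> linarith
    have hsm := hsp m hm
    have e1 : s m = i := by
      by_contra hne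
      obtain ⟨x, hx1, hx2⟩ := h2 m hm
      exact h3 m hm (s m) (by omega) i hi (by omega) hmi hne x hx1 hx2 (sub x hx1)
    obtain ⟨m', hm', hm'e⟩ := hpr m hm
    have hsm' := hsp m' hm'
    have e2 : m' = i := by
      by_contra hne
      obtain ⟨x, hx1, hx2⟩ := h2 m' hm'
      rw [hm'e] at hx2
      exact h3 m' hm' m hm i hi (by omega) hne hmi x hx1 hx2 (sub x hx2)
    subst e2
    omega
  have noA : ∀ m < ς, ∀ m' < ς, m ≠ i → m' ≠ i → m ≠ m' → a i ∈ angT (a m) (b m) → a i ∈ angT (a m') (b m') → False := by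
    intro m hm m' hm' h4 h5 h6 h7 h8
    have hcl : a i ∈ closure (Set.Ioo (a i) (b i)) := by
      rw [closure_Ioo (hab i hi).ne]; exact ⟨le_rfl, (hab i hi).le⟩
    obtain ⟨x, ⟨hx1, hx2⟩, hx3⟩ := mem_closure_iff.1 hcl _ ((angT_open (a m) (b m)).inter (angT_open (a m') (b m'))) ⟨h7, h8⟩
    exact h3 m hm m' hm' i hi h6 h4 h5 x hx1 hx2 ⟨0, by simpa using hx3⟩
  have noB : ∀ m < ς, ∀ m' < ς, m ≠ i → m' ≠ i → m ≠ m' → b i ∈ angT (a m) (b m) → b i ∈ angT (a m') (b m') → False := by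
    intro m hm m' hm' h4 h5 h6 h7 h8
    have hcl : b i ∈ closure (Set.Ioo (a i) (b i)) := by
      rw [closure_Ioo (hab i hi).ne]; exact ⟨(hab i hi).le, le_rfl⟩
    obtain ⟨x, ⟨hx1, hx2⟩, hx3⟩ := mem_closure_iff.1 hcl _ ((angT_open (a m) (b m)).inter (angT_open (a m') (b m'))) ⟨h7, h8⟩
    exact h3 m hm m' hm' i hi h6 h4 h5 x hx1 hx2 ⟨0, by simpa using hx3⟩
  obtain ⟨m', hm', hm'e⟩ := hpr i hi
  have hsm' := hsp m' hm'
  have k1 := endpt j hj (Ne.symm hij) ⟨t, hti, htj⟩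
  have k2 := endpt (s i) (by omega) (by omega) (h2 i hi)
  have k3 := endpt m' hm' (by omega) (by
    obtain ⟨x, hx1, hx2⟩ := h2 m' hm'
    rw [hm'e] at hx2
    exact ⟨x, hx2, hx1⟩)
  have d1 : j ≠ s i := hcon.1
  have d2 : j ≠ m' := by rintro rfl; exact hcon.2 hm'e.symm
  have d3 : s i ≠ m' := by omega
  have d4 : s i ≠ i := by omega
  have d5 : m' ≠ i := by omega
  have d6 : s i < ς := by omega
  rcases k1 with k1 | k1 <;> rcases k2 with k2 | k2 <;> rcases k3 with k3 | k3
  all_goals first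
    | exact noA _ hj _ d6 hij.symm d4 d1 k1 k2
    | exact noB _ hj _ d6 hij.symm d4 d1 k1 k2
    | exact noA _ hj _ hm' hij.symm d5 d2 k1 k3
    | exact noB _ hj _ hm' hij.symm d5 d2 k1 k3
    | exact noA _ d6 _ hm' d4 d5 d3 k2 k3
    | exact noB _ d6 _ hm' d4 d5 d3 k2 k3

open Complex in
lemma exists_P (ς : ℕ) (a b : ℕ → ℝ) (hcov : ∀ t : ℝ, ∃ p < ς, t ∈ angT (a p) (b p)) :
    ∃ n : ℕ, 1 ≤ n ∧ ∃ P : ℝ → Fin ς, ∀ t s : ℝ, |s - t| ≤ Real.pi / n → s ∈ angT (a (P t)) (b (P t)) := by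
  have hpi := Real.pi_pos
  obtain ⟨δ, hδ, hleb⟩ := lebesgue_number_lemma_of_metric (s := Set.Icc (0:ℝ) (2 * Real.pi))
    (c := fun p : Fin ς => angT (a p) (b p)) isCompact_Icc (fun p => angT_open _ _) (by
      intro t _
      obtain ⟨p, hp, h⟩ := hcov t
      exact Set.mem_iUnion.2 ⟨⟨p, hp⟩, h⟩)
  obtain ⟨n, hn⟩ := exists_nat_gt (Real.pi / δ)
  have hn0 : (0:ℝ) < n := lt_trans (by positivity) hn
  refine ⟨n, by exact_mod_cast hn0, ?_⟩
  have : ∀ t : ℝ, ∃ p : Fin ς, ∀ s : ℝ, |s - t| ≤ Real.pi / n → s ∈ angT (a p) (b p) := by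
    intro t
    obtain ⟨p, hp⟩ := hleb (t + (-⌊t / (2 * Real.pi)⌋ : ℤ) * (2 * Real.pi)) (by
      have h1 := Int.floor_le (t / (2 * Real.pi))
      have h2 := Int.lt_floor_add_one (t / (2 * Real.pi))
      rw [le_div_iff₀ (by positivity)] at h1
      rw [div_lt_iff₀ (by positivity)] at h2
      push_cast
      constructor <;> linarith)
    refine ⟨p, fun s hs => ?_⟩
    apply angT_shift _ _ _ (-⌊t / (2 * Real.pi)⌋ : ℤ)
    apply hp
    rw [Metric.mem_ball, Real.dist_eq, add_sub_add_right_eq_sub]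
    refine lt_of_le_of_lt hs ?_
    rw [div_lt_iff₀ hδ] at hn
    rw [div_lt_iff₀ hn0]; linarith
  choose P hP using this
  exact ⟨P, hP⟩

theorem stmt_11 {F : Type*} [NormedAddCommGroup F] [NormedSpace ℂ F] [CompleteSpace F]
    (q : ℝ) (hq : 1 < q) (k : ℕ) (hk : 1 ≤ k)
    (ς : ℕ) (hς : 2 ≤ ς) (eps0 : ℝ) (heps0 : 0 < eps0)
    (E : ℕ → Set ℂ) (hE : IsGoodCovering ς eps0 E)
    (G : ℕ → ℂ → F)
    (hol : ∀ p < ς, DifferentiableOn ℂ (G p) (E p))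
    (bdd : ∀ p < ς, ∃ M : ℝ, ∀ eps ∈ E p, ‖G p eps‖ ≤ M)
    (flat : ∀ p < ς, ∃ C1 : ℝ, ∃ C2 : ℝ, 0 < C2 ∧
      ∀ eps ∈ E p ∩ E ((p + 1) % ς),
        ‖G ((p + 1) % ς) eps - G p eps‖
          ≤ C2 * ‖eps‖ ^ C1 *
            Real.exp (-((k : ℝ) / (2 * Real.log q)) * (Real.log ‖eps‖) ^ 2)) :
    ∃ fn : ℕ → F, ∀ p < ς, qAsymp q k (E p) (G p) fn := by
  obtain ⟨hE1, hE2, hE3, hE4⟩ := hE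
  have hE1' : ∀ p : ℕ, ∃ θ1 θ2 : ℝ, p < ς → θ1 < θ2 ∧ E p = planarSector θ1 θ2 eps0 := by
    intro p
    by_cases hp : p < ς
    · obtain ⟨θ1, θ2, h1, _, h2⟩ := hE1 p hp
      exact ⟨θ1, θ2, fun _ => ⟨h1, h2⟩⟩
    · exact ⟨0, 0, fun h => absurd h hp⟩
  choose a b hab using hE1'
  have hmem : ∀ p < ς, ∀ w : ℂ, Complex.exp w ∈ E p ↔ w.re < Real.log eps0 ∧ w.im ∈ angT (a p) (b p) := by
    intro p hp w
    rw [(hab p hp).2, mem_sector _ _ _ heps0]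
    rfl
  have hsub : ∀ p < ς, ∀ z ∈ E p, z ≠ 0 ∧ ‖z‖ < eps0 := by
    intro p hp z hz
    have : z ∈ Metric.ball (0 : ℂ) eps0 \ {0} := by
      rw [← hE4]
      exact Set.mem_biUnion (Finset.mem_range.2 hp) hz
    exact ⟨by simpa using this.2, by simpa using this.1⟩
  have hmod : ∀ p, (p + 1) % ς < ς := fun p => Nat.mod_lt _ (by omega)
  have hmemT : ∀ p < ς, ∀ z ∈ E p, (Complex.log z).im ∈ angT (a p) (b p) := by
    intro p hp z hz
    have h := hz
    rw [← Complex.exp_log (hsub p hp z hz).1] at h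
    exact ((hmem p hp _).1 h).2
  have hadj := adj_of_meet ς hς a b (fun p hp => (hab p hp).1)
    (by
      intro p hp
      obtain ⟨z, hz1, hz2⟩ := hE2 p hp
      exact ⟨(Complex.log z).im, hmemT p hp z hz1, hmemT _ (hmod p) z hz2⟩)
    (by
      intro p1 h1 p2 h2 p3 h3 n1 n2 n3 t t1 t2 t3
      have he := hE3 p1 h1 p2 h2 p3 h3 n1 n2 n3
      have hlt : Real.log (eps0 / 2) < Real.log eps0 := Real.log_lt_log (by positivity) (by linarith)
      have m : ∀ p < ς, t ∈ angT (a p) (b p) → Complex.exp (Real.log (eps0 / 2) + t * Complex.I) ∈ E p := by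
        intro p hp ht
        rw [hmem p hp]
        refine ⟨?_, ?_⟩
        · simp only [Complex.add_re, Complex.ofReal_re, Complex.re_ofReal_mul, Complex.I_re, mul_zero, add_zero]
          exact hlt
        · simpa only [Complex.add_im, Complex.ofReal_im, Complex.im_ofReal_mul, Complex.I_im, mul_one, zero_add] using ht
      have : Complex.exp (Real.log (eps0 / 2) + t * Complex.I) ∈ E p1 ∩ E p2 ∩ E p3 :=
        ⟨⟨m p1 h1 t1, m p2 h2 t2⟩, m p3 h3 t3⟩
      rw [he] at this
      exact this)
  obtain ⟨n, hn, P, hP⟩ := exists_P ς a b (by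
    intro t
    have hm : ((eps0 / 2 : ℝ) : ℂ) * Complex.exp (t * Complex.I) ∈ Metric.ball (0 : ℂ) eps0 \ {0} := by
      constructor
      · rw [mem_ball_zero_iff, norm_mul, Complex.norm_exp_ofReal_mul_I, Complex.norm_real, Real.norm_eq_abs,
          abs_of_pos (by positivity)]
        linarith
      · simp [heps0.ne']
    rw [← hE4] at hm
    simp only [Set.mem_iUnion, Finset.mem_range] at hm
    obtain ⟨p, hp, hz⟩ := hm
    refine ⟨p, hp, ?_⟩
    have e : ((eps0 / 2 : ℝ) : ℂ) * Complex.exp (t * Complex.I) = Complex.exp (Real.log (eps0 / 2) + t * Complex.I) := by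
      rw [Complex.exp_add, ← Complex.ofReal_exp, Real.exp_log (by positivity)]
    rw [e, hmem p hp] at hz
    simpa only [Complex.add_im, Complex.ofReal_im, Complex.im_ofReal_mul, Complex.I_im, mul_one, zero_add] using hz.2)
  obtain ⟨C, hC, hstep⟩ := rs_step F (fun p : Fin ς => E p) n hn P eps0 heps0
    (fun p => by rw [(hab p p.2).2]; exact sector_open _ _ _ heps0)
    (fun p => hsub p p.2)
    (fun t w h1 h2 => (hmem _ (P t).2 w).2 ⟨h2, hP t _ h1⟩)
  -- uniform flatness
  have fl : ∀ p : Fin ς, ∃ D B : ℝ, 0 < D ∧ 0 < B ∧ ∀ z ∈ E p, z ∈ E ((p + 1) % ς) → ∀ N : ℕ,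
      ‖G ((p + 1) % ς) z - G p z‖ ≤ D * B ^ N * q ^ (((N:ℝ) + 1) * N / (2 * k)) * ‖z‖ ^ (N + 2) := by
    intro p
    obtain ⟨C1, C2, hC2, h⟩ := flat p p.2
    refine ⟨C2 * q ^ ((2 - C1)^2 / (2 * k) : ℝ), q ^ ((3 - 2 * C1) / (2 * k) : ℝ), by positivity, by positivity, ?_⟩
    intro z h1 h2 N
    exact (h z ⟨h1, h2⟩).trans (flat_bound q hq k hk C1 C2 hC2 N ‖z‖ (norm_pos_iff.2 (hsub p p.2 z h1).1))
  choose D B hD hB hfl using fl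
  have bd : ∀ p : Fin ς, ∃ M : ℝ, ∀ z ∈ E p, ‖G p z‖ ≤ M := fun p => bdd p p.2
  choose M hM using bd
  haveI : Nonempty (Fin ς) := ⟨⟨0, by omega⟩⟩
  have hDs : ∀ p, D p ≤ ∑ p, D p := fun p => Finset.single_le_sum (fun i _ => (hD i).le) (Finset.mem_univ p)
  have hBs : ∀ p, B p ≤ ∑ p, B p := fun p => Finset.single_le_sum (fun i _ => (hB i).le) (Finset.mem_univ p)
  have hMs : ∀ p, M p ≤ ∑ p, |M p| := fun p => (le_abs_self _).trans
    (Finset.single_le_sum (f := fun p => |M p|) (fun i _ => abs_nonneg _) (Finset.mem_univ p))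
  have hDp : 0 < ∑ p, D p := Finset.sum_pos (fun i _ => hD i) Finset.univ_nonempty
  have hBp : 0 < ∑ p, B p := Finset.sum_pos (fun i _ => hB i) Finset.univ_nonempty
  have up : ∀ p : Fin ς, ∀ (N : ℕ) (z : ℂ), D p * B p ^ N * q ^ (((N:ℝ) + 1) * N / (2 * k)) * ‖z‖ ^ (N + 2) ≤
      (∑ p, D p) * (∑ p, B p) ^ N * q ^ (((N:ℝ) + 1) * N / (2 * k)) * ‖z‖ ^ (N + 2) := by
    intro p N z
    have := (hB p).le
    have := hDs p
    have := hBs p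
    gcongr
  obtain ⟨fn, A, D', hA, hD', hfin⟩ := rs_induct (fun p : Fin ς => E p) (fun p z hz => (hsub p p.2 z hz).1)
    q hq k hk C hC hstep (fun p => G p) (fun p => hol p p.2) (∑ p, |M p|) (∑ p, D p) (∑ p, B p) hDp hBp
    (fun p z hz => (hM p z hz).trans (hMs p))
    (by
      intro i j z hi hj N
      by_cases hij : (i : ℕ) = j
      · have : i = j := Fin.ext hij
        subst this
        rw [sub_self, norm_zero]
        positivity
      · rcases hadj i j i.2 j.2 hij _ (hmemT i i.2 z hi) (hmemT j j.2 z hj) with h | h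
        · rw [norm_sub_rev]
          have h1 := hfl i z hi (h ▸ hj) N
          rw [← h] at h1
          exact h1.trans (up i N z)
        · have h1 := hfl j z hj (h ▸ hi) N
          rw [← h] at h1
          exact h1.trans (up j N z))
  refine ⟨fn, fun p hp θ1 θ2 r hs _ => ⟨A, D', hA, hD', fun N z hz => ?_⟩⟩
  exact hfin ⟨p, hp⟩ N z (hs hz)
end
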